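/- arXiv:1402.6796 — 2 statements merged into one kernel-verified Lean document; each statement's English description precedes it below -/
import Mathlib

section
/- Let g be a non-compact real simple Lie algebra without complex structure, φ the highest root of Δ+(g_C,h_C), τ* the involution of h* induced by the conjugation τ of g_C with respect to g, and λ = φ|_a the highest restricted root. If φ is not a real root, then ⟨φ, τ*φ⟩ = 0, and consequently ⟨φ,φ⟩ = 2⟨λ,λ⟩. -/
/-!
Common definitions: a complex simple Lie algebra `gC`, real forms, Cartan decompositions,
restricted roots, inner automorphism groups, adjoint orbits and the closure ordering.
-/

open LieAlgebra Set

namespace SmallestOrbitPaper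

variable {gC : Type*} [LieRing gC] [LieAlgebra ℂ gC]

/-- `g` is a real form of the complex Lie algebra `gC`:
an `ℝ`-subspace closed under the bracket with `gC = g ⊕ √-1 g`. -/
structure IsRealForm (g : Submodule ℝ gC) : Prop where
  lie_mem : ∀ x ∈ g, ∀ y ∈ g, ⁅x, y⁆ ∈ g
  spans : ∀ z : gC, ∃ x ∈ g, ∃ y ∈ g, z = x + Complex.I • y
  indep : ∀ x ∈ g, Complex.I • x ∈ g → x = 0

/-- `g = k ⊕ p` is a Cartan decomposition of the real form `g`
(the Killing form is negative definite on `k` and positive definite on `p`). -/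
structure IsCartanDecomposition (g k p : Submodule ℝ gC) : Prop where
  k_le : k ≤ g
  p_le : p ≤ g
  sup_eq : k ⊔ p = g
  inf_eq : k ⊓ p = ⊥
  lie_kk : ∀ x ∈ k, ∀ y ∈ k, ⁅x, y⁆ ∈ k
  lie_kp : ∀ x ∈ k, ∀ y ∈ p, ⁅x, y⁆ ∈ p
  lie_pp : ∀ x ∈ p, ∀ y ∈ p, ⁅x, y⁆ ∈ k
  killing_neg : ∀ x ∈ k, x ≠ 0 → ((killingForm ℂ gC) x x).re < 0
  killing_pos : ∀ x ∈ p, x ≠ 0 → 0 < ((killingForm ℂ gC) x x).re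

/-- `a` is a maximal abelian subspace of `p`. -/
structure IsMaximalAbelianIn (a p : Submodule ℝ gC) : Prop where
  le : a ≤ p
  abelian : ∀ x ∈ a, ∀ y ∈ a, ⁅x, y⁆ = 0
  maximal : ∀ x ∈ p, (∀ y ∈ a, ⁅x, y⁆ = 0) → x ∈ a

/-- The restricted root space `g_ξ ⊆ g` for a functional `ξ` on `a`. -/
def restrictedRootSpace (g a : Submodule ℝ gC) (ξ : Module.Dual ℝ a) : Set gC :=
  {x | x ∈ g ∧ ∀ H : a, ⁅(H : gC), x⁆ = ((ξ H : ℝ) : ℂ) • x}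

/-- The restricted root system `Σ(g, a)`. -/
def restrictedRoots (g a : Submodule ℝ gC) : Set (Module.Dual ℝ a) :=
  {ξ | ξ ≠ 0 ∧ ∃ x ∈ restrictedRootSpace g a ξ, x ≠ 0}

/-- `P` is a positive system `Σ⁺(g, a)` of the restricted root system. -/
structure IsPositiveSystem (g a : Submodule ℝ gC) (P : Set (Module.Dual ℝ a)) : Prop where
  subset : P ⊆ restrictedRoots g a
  total : ∀ ξ ∈ restrictedRoots g a, ξ ∈ P ∨ -ξ ∈ P
  not_both : ∀ ξ ∈ P, -ξ ∉ P
  add_mem : ∀ ξ ∈ P, ∀ η ∈ P, ξ + η ∈ restrictedRoots g a → ξ + η ∈ P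

/-- `lam` is the highest root of `Σ⁺(g,a)`: it is positive and `lam - ξ` is a sum of
positive roots for every root `ξ`. -/
def IsHighestRestrictedRoot (g a : Submodule ℝ gC) (P : Set (Module.Dual ℝ a))
    (lam : Module.Dual ℝ a) : Prop :=
  lam ∈ P ∧ ∀ ξ ∈ restrictedRoots g a, lam - ξ ∈ AddSubmonoid.closure P

/-- The exponential of a nilpotent endomorphism (a finite sum, since the nilpotency
index is at most `finrank ℂ gC`). -/
noncomputable def expNilpotent (f : Module.End ℂ gC) : Module.End ℂ gC :=
  ∑ n ∈ Finset.range (Module.finrank ℂ gC + 1), (n.factorial : ℂ)⁻¹ • f ^ n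

/-- The group of automorphisms of `gC` generated by `exp (ad x)` for `x ∈ S` with `ad x`
nilpotent.  For `S = gC` this is `Int(gC)`; for `S = g` a noncompact real form,
this is `Int(g)` (acting on `gC`). -/
def innerAut (S : Set gC) : Subgroup (gC ≃ₗ[ℂ] gC) :=
  Subgroup.closure
    {e | ∃ x ∈ S, IsNilpotent (ad ℂ gC x) ∧ (e : gC →ₗ[ℂ] gC) = expNilpotent (ad ℂ gC x)}

/-- The orbit of `x` under a subgroup `H` of automorphisms of `gC`. -/
def adOrbit (H : Subgroup (gC ≃ₗ[ℂ] gC)) (x : gC) : Set gC := {y | ∃ h ∈ H, h x = y}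

/-- `O` is a non-zero complex nilpotent (adjoint) orbit in `gC`. -/
def IsComplexNilpotentOrbit (O : Set gC) : Prop :=
  ∃ x : gC, x ≠ 0 ∧ IsNilpotent (ad ℂ gC x) ∧ O = adOrbit (innerAut (univ : Set gC)) x

/-- `O` is a non-zero complex nilpotent orbit meeting the real form `g`,
i.e. `O ∈ (N_g / G_ℂ) \ {[0]}`. -/
def IsComplexNilpotentOrbitMeeting (g : Submodule ℝ gC) (O : Set gC) : Prop :=
  IsComplexNilpotentOrbit O ∧ ∃ y ∈ O, y ∈ g

/-- `O` is the minimum of `(N_g / G_ℂ) \ {[0]}` with respect to the closure ordering;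
this is the orbit `O_{min, g}` of the paper. -/
def IsMinOrbitMeeting [TopologicalSpace gC] (g : Submodule ℝ gC) (O : Set gC) : Prop :=
  IsComplexNilpotentOrbitMeeting g O ∧
    ∀ O', IsComplexNilpotentOrbitMeeting g O' → O ⊆ closure O'

/-- `O` is the minimal nilpotent orbit `O_min^{G_ℂ}` of `gC`, i.e. the minimum of
`(N / G_ℂ) \ {[0]}` with respect to the closure ordering. -/
def IsMinNilpotentOrbit [TopologicalSpace gC] (O : Set gC) : Prop :=
  IsComplexNilpotentOrbit O ∧ ∀ O', IsComplexNilpotentOrbit O' → O ⊆ closure O'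

/-- `O` is a non-zero real nilpotent orbit in the real form `g`, i.e. an orbit of
`G = Int(g)` through a non-zero nilpotent element of `g`. -/
def IsRealNilpotentOrbit (g : Submodule ℝ gC) (O : Set gC) : Prop :=
  ∃ x : gC, x ∈ g ∧ x ≠ 0 ∧ IsNilpotent (ad ℂ gC x) ∧ O = adOrbit (innerAut (g : Set gC)) x

/-- The complex dimension of the adjoint orbit through `x`: `dim_ℂ [gC, x]`. -/
noncomputable def cdim (x : gC) : ℕ := Module.finrank ℂ (LinearMap.range (ad ℂ gC x))

/-- The real dimension of the `Int(g)`-orbit through `x ∈ g`: `dim_ℝ [g, x]`. -/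
noncomputable def rdim (g : Submodule ℝ gC) (x : gC) : ℕ :=
  Module.finrank ℝ (Submodule.map ((ad ℂ gC x : gC →ₗ[ℂ] gC).restrictScalars ℝ) g)

/-- The dimension of the `K_ℂ`-orbit through `x`: `dim_ℂ [k_ℂ, x]`. -/
noncomputable def kdim (k : Submodule ℝ gC) (x : gC) : ℕ :=
  Module.finrank ℂ (Submodule.map (ad ℂ gC x : gC →ₗ[ℂ] gC) (Submodule.span ℂ (k : Set gC)))

/-- `(g, k)` is of Hermitian type: the center of `k` is non-zero. -/
def IsHermitianPair (k : Submodule ℝ gC) : Prop :=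
  ∃ z ∈ k, z ≠ 0 ∧ ∀ x ∈ k, ⁅z, x⁆ = 0

/-! ### Roots of the complex Lie algebra with respect to a Cartan subalgebra -/

/-- The root space of a functional `χ` on a Cartan subalgebra `hC` of `gC`. -/
def rootSpaceC (hC : LieSubalgebra ℂ gC) (χ : Module.Dual ℂ hC) : Set gC :=
  {x | ∀ H : hC, ⁅(H : gC), x⁆ = χ H • x}

/-- The root system `Δ(gC, hC)`. -/
def rootsC (hC : LieSubalgebra ℂ gC) : Set (Module.Dual ℂ hC) :=
  {χ | χ ≠ 0 ∧ ∃ x ∈ rootSpaceC hC χ, x ≠ 0}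

/-- `PC` is a positive system `Δ⁺(gC, hC)`. -/
structure IsPositiveSystemC (hC : LieSubalgebra ℂ gC) (PC : Set (Module.Dual ℂ hC)) : Prop where
  subset : PC ⊆ rootsC hC
  total : ∀ χ ∈ rootsC hC, χ ∈ PC ∨ -χ ∈ PC
  not_both : ∀ χ ∈ PC, -χ ∉ PC
  add_mem : ∀ χ ∈ PC, ∀ ψ ∈ PC, χ + ψ ∈ rootsC hC → χ + ψ ∈ PC

/-- `φ` is the highest root of `Δ⁺(gC, hC)`. -/
def IsHighestRootC (hC : LieSubalgebra ℂ gC) (PC : Set (Module.Dual ℂ hC))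
    (φ : Module.Dual ℂ hC) : Prop :=
  φ ∈ PC ∧ ∀ χ ∈ rootsC hC, φ - χ ∈ AddSubmonoid.closure PC

/-- The simple system `Π` of the positive system `PC` (indecomposable positive roots). -/
def simpleSystemC (hC : LieSubalgebra ℂ gC) (PC : Set (Module.Dual ℂ hC)) :
    Set (Module.Dual ℂ hC) :=
  {α | α ∈ PC ∧ ¬∃ β ∈ PC, ∃ γ ∈ PC, α = β + γ}

/-- `χ` restricts to zero on `a`; for a simple root this says that the corresponding node
of the Satake diagram is black. -/
def VanishesOnA (hC : LieSubalgebra ℂ gC) (a : Submodule ℝ gC) (hah : ∀ x ∈ a, x ∈ hC)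
    (χ : Module.Dual ℂ hC) : Prop :=
  ∀ x : gC, ∀ hx : x ∈ a, χ ⟨x, hah x hx⟩ = 0

/-- `χ` and `ψ` have the same restriction to `a`; for two distinct white simple roots this
says that they are joined by an arrow in the Satake diagram. -/
def SameRestrictionOnA (hC : LieSubalgebra ℂ gC) (a : Submodule ℝ gC)
    (hah : ∀ x ∈ a, x ∈ hC) (χ ψ : Module.Dual ℂ hC) : Prop :=
  ∀ x : gC, ∀ hx : x ∈ a, χ ⟨x, hah x hx⟩ = ψ ⟨x, hah x hx⟩

/-- Two distinct white (non-black) simple roots joined by an arrow in the Satake diagram. -/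
def JoinedByArrow (hC : LieSubalgebra ℂ gC) (a : Submodule ℝ gC) (hah : ∀ x ∈ a, x ∈ hC)
    (PC : Set (Module.Dual ℂ hC)) (α β : Module.Dual ℂ hC) : Prop :=
  α ∈ simpleSystemC hC PC ∧ β ∈ simpleSystemC hC PC ∧ α ≠ β ∧
    ¬VanishesOnA hC a hah α ∧ ¬VanishesOnA hC a hah β ∧ SameRestrictionOnA hC a hah α β

/-- The positive system `PC` of `Δ(gC,hC)` is compatible with the positive system `P` of
`Σ(g,a)` (the ordering on `h` extends the ordering on `a`): the non-zero restriction of a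
positive root is a positive restricted root. -/
def CompatiblePositiveSystems (hC : LieSubalgebra ℂ gC) (a : Submodule ℝ gC)
    (hah : ∀ x ∈ a, x ∈ hC) (PC : Set (Module.Dual ℂ hC)) (P : Set (Module.Dual ℝ a)) : Prop :=
  ∀ χ ∈ PC, ¬VanishesOnA hC a hah χ →
    ∃ ξ ∈ P, ∀ x : gC, ∀ hx : x ∈ a, χ ⟨x, hah x hx⟩ = ((ξ ⟨x, hx⟩ : ℝ) : ℂ)

/-- `φ` is a real root: it vanishes on `√-1 t = {x ∈ hC | √-1 x ∈ k}`. -/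
def IsRealRootWRT (hC : LieSubalgebra ℂ gC) (k : Submodule ℝ gC)
    (φ : Module.Dual ℂ hC) : Prop :=
  ∀ x : gC, ∀ hx : x ∈ hC, Complex.I • x ∈ k → φ ⟨x, hx⟩ = 0

/-! ### The classification list -/

/-- `f` intertwines the Lie bracket of `g ⊆ gC` and the commutator bracket of the
associative algebra `A`. -/
def BracketCompatible (g : Submodule ℝ gC) {A : Type*} [Ring A] [Algebra ℝ A]
    (f : g →ₗ[ℝ] A) : Prop :=
  ∀ x y z : g, (z : gC) = ⁅(x : gC), (y : gC)⁆ → f z = f x * f y - f y * f x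

/-- `g ≅ su*(2m) = sl(m, ℍ)`: quaternionic `m × m` matrices whose trace has zero real
part. -/
def IsomorphicToSuStar (g : Submodule ℝ gC) (m : ℕ) : Prop :=
  ∃ f : g →ₗ[ℝ] Matrix (Fin m) (Fin m) (Quaternion ℝ),
    Function.Injective f ∧ BracketCompatible g f ∧
    (LinearMap.range f : Set (Matrix (Fin m) (Fin m) (Quaternion ℝ))) =
      {X | (Matrix.trace X).re = 0}

/-- The Lorentz form `diag(1, …, 1, -1)` of signature `(n-1, 1)`. -/
noncomputable def lorentzJ (n : ℕ) : Matrix (Fin n) (Fin n) ℝ :=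
  Matrix.diagonal fun i => if (i : ℕ) < n - 1 then 1 else -1

/-- `g ≅ so(n-1, 1)`. -/
def IsomorphicToSoLorentz (g : Submodule ℝ gC) (n : ℕ) : Prop :=
  ∃ f : g →ₗ[ℝ] Matrix (Fin n) (Fin n) ℝ,
    Function.Injective f ∧ BracketCompatible g f ∧
    (LinearMap.range f : Set (Matrix (Fin n) (Fin n) ℝ)) =
      {X | X.transpose * lorentzJ n + lorentzJ n * X = 0}

/-- The quaternionic Hermitian form `diag(1_p, -1_q)`. -/
noncomputable def spJ (p q : ℕ) : Matrix (Fin (p + q)) (Fin (p + q)) (Quaternion ℝ) :=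
  Matrix.diagonal fun i => if (i : ℕ) < p then 1 else -1

/-- `g ≅ sp(p, q)`. -/
def IsomorphicToSpPQ (g : Submodule ℝ gC) (p q : ℕ) : Prop :=
  ∃ f : g →ₗ[ℝ] Matrix (Fin (p + q)) (Fin (p + q)) (Quaternion ℝ),
    Function.Injective f ∧ BracketCompatible g f ∧
    (LinearMap.range f : Set (Matrix (Fin (p + q)) (Fin (p + q)) (Quaternion ℝ))) =
      {X | X.conjTranspose * spJ p q + spJ p q * X = 0}

/-- `g ≅ e_{6(-26)}`: among noncompact absolutely simple real Lie algebras this is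
characterized by `dim_ℝ g = 78` together with the character
`dim p - dim k = -26` of a Cartan decomposition `g = k ⊕ p`. -/
def IsE6Minus26 (g k p : Submodule ℝ gC) : Prop :=
  Module.finrank ℝ g = 78 ∧ (Module.finrank ℝ p : ℤ) - (Module.finrank ℝ k : ℤ) = -26

/-- `g ≅ f_{4(-20)}`: characterized by `dim_ℝ g = 52` and character `-20`. -/
def IsF4Minus20 (g k p : Submodule ℝ gC) : Prop :=
  Module.finrank ℝ g = 52 ∧ (Module.finrank ℝ p : ℤ) - (Module.finrank ℝ k : ℤ) = -20

/-- `g` is isomorphic to one of `su*(2k)` (k ≥ 2), `so(n-1,1)` (n ≥ 5), `sp(p,q)`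
(p, q ≥ 1), `f_{4(-20)}`, `e_{6(-26)}`. -/
def InClassificationList (g k p : Submodule ℝ gC) : Prop :=
  (∃ m : ℕ, 2 ≤ m ∧ IsomorphicToSuStar g m) ∨
  (∃ n : ℕ, 5 ≤ n ∧ IsomorphicToSoLorentz g n) ∨
  (∃ p' q' : ℕ, 1 ≤ p' ∧ 1 ≤ q' ∧ IsomorphicToSpPQ g p' q') ∨
  IsF4Minus20 g k p ∨ IsE6Minus26 g k p

/-! ### Groups: `K_ℂ`, `K`, `M`, `A`, and `MA`-orbits -/

/-- Topology on the automorphism group of `gC`, induced from pointwise convergence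
(equivalently, for finite-dimensional `gC`, the standard topology). -/
noncomputable instance autTopology [TopologicalSpace gC] :
    TopologicalSpace (gC ≃ₗ[ℂ] gC) :=
  TopologicalSpace.induced (fun e => (e : gC → gC)) Pi.topologicalSpace

/-- The exponentials `exp (ad z)` of elements `z ∈ S` with `ad z` diagonalizable:
`h = exp (ad z)` is characterized by `h x = e^c • x` on eigenvectors, which span. -/
def expSemisimpleSet (S : Set gC) : Set (gC ≃ₗ[ℂ] gC) :=
  {h | ∃ z ∈ S, Submodule.span ℂ {x : gC | ∃ c : ℂ, ⁅z, x⁆ = c • x} = ⊤ ∧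
      ∀ (c : ℂ) (x : gC), ⁅z, x⁆ = c • x → h x = Complex.exp c • x}

/-- The connected subgroup of `Int(gC)` with Lie algebra the (algebraic, reductive)
subalgebra spanned by `S`: generated by exponentials of nilpotent and of semisimple
elements of `S`.  For `S = k_ℂ` this is the group `K_ℂ`. -/
def connectedSubgroupOf (S : Set gC) : Subgroup (gC ≃ₗ[ℂ] gC) :=
  Subgroup.closure
    ({e | ∃ x ∈ S, IsNilpotent (ad ℂ gC x) ∧ (e : gC →ₗ[ℂ] gC) = expNilpotent (ad ℂ gC x)}
      ∪ expSemisimpleSet S)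

/-- The subgroup `A = exp a`: `exp (ad H)` for `H ∈ a` is characterized by its action on
the (spanning) eigenvectors of `ad H`, which has real eigenvalues. -/
def expAOf (a : Submodule ℝ gC) : Set (gC ≃ₗ[ℂ] gC) :=
  {h | ∃ H ∈ a, Submodule.span ℂ {x : gC | ∃ c : ℝ, ⁅H, x⁆ = (c : ℂ) • x} = ⊤ ∧
      ∀ (c : ℝ) (x : gC), ⁅H, x⁆ = (c : ℂ) • x → h x = ((Real.exp c : ℝ) : ℂ) • x}

/-- `M = Z_K(a)`, the centralizer of `a` in `K`. -/
def centralizerSetOf (K : Subgroup (gC ≃ₗ[ℂ] gC)) (a : Submodule ℝ gC) :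
    Set (gC ≃ₗ[ℂ] gC) :=
  {h | h ∈ K ∧ ∀ x ∈ a, h x = x}

/-- `N_K(a)`, the normalizer of `a` in `K`. -/
def normalizerSetOf (K : Subgroup (gC ≃ₗ[ℂ] gC)) (a : Submodule ℝ gC) :
    Set (gC ≃ₗ[ℂ] gC) :=
  {h | h ∈ K ∧ ∀ x : gC, x ∈ a ↔ h x ∈ a}

/-- The `MA`-orbit of `x`, where `M = Z_K(a)` and `A = exp a`. -/
def MAOrbit (K : Subgroup (gC ≃ₗ[ℂ] gC)) (a : Submodule ℝ gC) (x : gC) : Set gC :=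
  {y | ∃ m ∈ centralizerSetOf K a, ∃ t ∈ expAOf a, (m * t) x = y}

/-- `K` is a maximal compact subgroup of `G`. -/
def IsMaximalCompactIn [TopologicalSpace gC] (G K : Subgroup (gC ≃ₗ[ℂ] gC)) : Prop :=
  K ≤ G ∧ IsCompact (K : Set (gC ≃ₗ[ℂ] gC)) ∧
    ∀ K' : Subgroup (gC ≃ₗ[ℂ] gC), K' ≤ G → IsCompact (K' : Set (gC ≃ₗ[ℂ] gC)) →
      K ≤ K' → K' = K

/-- `M₀`, the identity component of `M = Z_K(a)`. -/
def MZero [TopologicalSpace gC] (K : Subgroup (gC ≃ₗ[ℂ] gC)) (a : Submodule ℝ gC) :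
    Set (gC ≃ₗ[ℂ] gC) :=
  {h | ∃ hh : h ∈ centralizerSetOf K a,
    (⟨h, hh⟩ : centralizerSetOf K a) ∈
      connectedComponent (α := centralizerSetOf K a)
        ⟨1, K.one_mem, fun x _ => rfl⟩}

/-- The `M₀A`-orbit of `x`. -/
def MZeroAOrbit [TopologicalSpace gC] (K : Subgroup (gC ≃ₗ[ℂ] gC)) (a : Submodule ℝ gC)
    (x : gC) : Set gC :=
  {y | ∃ m ∈ MZero K a, ∃ t ∈ expAOf a, (m * t) x = y}


/-! ### Auxiliary lemmas for the proof -/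

section Aux1

set_option linter.unusedSectionVars false

variable [FiniteDimensional ℂ gC] [LieAlgebra.IsKilling ℂ gC]
variable (hC : LieSubalgebra ℂ gC) [hC.IsCartanSubalgebra]

lemma aux_mem_rootSpace {χ : Module.Dual ℂ hC} {x : gC} (hx : x ∈ rootSpaceC hC χ) :
    x ∈ rootSpace hC (χ : hC → ℂ) := by
  refine LieModule.weightSpace_le_genWeightSpace gC _ ?_
  rw [LieModule.mem_weightSpace]
  exact fun H => hx H

/-- The weight attached to an element of `rootsC`. -/
lemma aux_weight {χ : Module.Dual ℂ hC} (hχ : χ ∈ rootsC hC) :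
    ∃ α : LieModule.Weight ℂ hC gC, α.IsNonZero ∧ ∀ H, α H = χ H := by
  obtain ⟨h0, x, hx, hx0⟩ := hχ
  refine ⟨⟨χ, ?_⟩, ?_, fun _ => rfl⟩
  · intro h
    have := aux_mem_rootSpace hC hx
    rw [rootSpace, h] at this
    exact hx0 (by simpa using this)
  · intro h
    apply h0
    ext H
    exact congrFun h H

lemma aux_sl2 {χ : Module.Dual ℂ hC} (hχ : χ ∈ rootsC hC) :
    ∃ (h : hC) (e f : gC), IsSl2Triple (h : gC) e f ∧ e ∈ rootSpaceC hC χ ∧ e ≠ 0 ∧ χ h = 2 ∧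
      ∃ c : ℂ, ∀ H : hC, killingForm ℂ gC h H = c * χ H := by
  obtain ⟨α, hα, hαχ⟩ := aux_weight hC hχ
  obtain ⟨h, e, f, ht, he, hf⟩ := LieAlgebra.IsKilling.exists_isSl2Triple_of_weight_isNonZero hα
  obtain rfl := ht.h_eq_coroot hα he hf
  refine ⟨IsKilling.coroot α, e, f, ht, ?_, ht.e_ne_zero, ?_, ?_⟩
  · intro H
    rw [← hαχ]
    exact LieAlgebra.IsKilling.lie_eq_smul_of_mem_rootSpace he H
  · rw [← hαχ]; exact LieAlgebra.IsKilling.root_apply_coroot hα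
  · refine ⟨2 * (α <| (IsKilling.cartanEquivDual hC).symm α)⁻¹, fun H => ?_⟩
    have := IsKilling.traceForm_coroot α H
    rw [← hαχ]
    rw [mul_assoc]
    simp only [smul_eq_mul, nsmul_eq_mul, Nat.cast_ofNat] at this
    exact this

lemma aux_nondeg {x : gC} (hx : x ∈ hC) (h : ∀ y ∈ hC, killingForm ℂ gC x y = 0) : x = 0 := by
  have := IsKilling.ker_restrict_eq_bot_of_isCartanSubalgebra ℂ gC hC
  have h2 : (⟨x, hx⟩ : hC) ∈ LinearMap.ker ((killingForm ℂ gC).restrict hC.toSubmodule) := by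
    rw [LinearMap.mem_ker]
    ext y
    exact h y y.2
  have h3 := (Submodule.eq_bot_iff _).1 this _ h2
  exact congrArg Subtype.val h3

lemma aux_lie_add {χ ψ : Module.Dual ℂ hC} {x y : gC} (hx : x ∈ rootSpaceC hC χ)
    (hy : y ∈ rootSpaceC hC ψ) : ⁅x, y⁆ ∈ rootSpaceC hC (χ + ψ) := by
  intro H
  rw [leibniz_lie, hx H, hy H, smul_lie, lie_smul, ← add_smul]
  rfl

/-- If the bracket of a root vector with another weight vector vanishes, the pairing is a
natural number. -/
lemma aux_nat {h e f y : gC} (ht : IsSl2Triple h e f) (hy : y ≠ 0) {μ : ℂ}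
    (h1 : ⁅h, y⁆ = μ • y) (h2 : ⁅e, y⁆ = 0) : ∃ n : ℕ, μ = n :=
  IsSl2Triple.HasPrimitiveVectorWith.exists_nat (t := ht) ⟨hy, h1, h2⟩

lemma aux_nat_of_not_root {χ ψ : Module.Dual ℂ hC} (hψ : ψ ∈ rootsC hC) {h : hC} {e f : gC}
    (ht : IsSl2Triple (h : gC) e f) (he : e ∈ rootSpaceC hC χ)
    (hn : χ + ψ ∉ rootsC hC) (hn0 : χ + ψ ≠ 0) : ∃ n : ℕ, ψ h = n := by
  obtain ⟨-, y, hy, hy0⟩ := hψ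
  refine aux_nat ht hy0 (hy h) ?_
  by_contra hne
  exact hn ⟨hn0, _, aux_lie_add hC he hy, hne⟩

/-- A non-empty sum of positive roots is non-zero. -/
lemma aux_sum_ne_zero {PC : Set (Module.Dual ℂ hC)} (hPC : IsPositiveSystemC hC PC) (n : ℕ) :
    ∀ (β : Module.Dual ℂ hC) (s : Multiset (Module.Dual ℂ hC)), s.card = n → β ∈ PC →
      (∀ γ ∈ s, γ ∈ PC) → β + s.sum ≠ 0 := by
  induction n with
  | zero =>
    intro β s hs hβ _ h0
    rw [Multiset.card_eq_zero] at hs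
    subst hs
    exact (hPC.subset hβ).1 (by simpa using h0)
  | succ n ih =>
    intro β s hs hβ hsP h0
    obtain ⟨h, e, f, ht, he, he0, h2, -⟩ := aux_sl2 hC (hPC.subset hβ)
    by_cases hall : ∀ γ ∈ s, ∃ m : ℕ, γ h = m
    · have key : ∀ t : Multiset (Module.Dual ℂ hC), (∀ γ ∈ t, ∃ m : ℕ, γ h = m) →
          ∃ m : ℕ, t.sum h = m := by
        intro t
        induction t using Multiset.induction_on with
        | empty => intro _; exact ⟨0, by simp⟩
        | cons a t iht =>
          intro hh
          obtain ⟨m1, h1⟩ := hh a (Multiset.mem_cons_self _ _)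
          obtain ⟨m2, h2⟩ := iht fun γ hγ => hh γ (Multiset.mem_cons_of_mem hγ)
          exact ⟨m1 + m2, by simp [h1, h2]⟩
      obtain ⟨m, hm⟩ := key s hall
      have := congrArg (fun ξ : Module.Dual ℂ hC => ξ h) h0
      simp only [LinearMap.add_apply, LinearMap.zero_apply, h2, hm] at this
      have h3 : ((2 + m : ℕ) : ℂ) = 0 := by push_cast; exact this
      have h4 := Nat.cast_eq_zero.1 h3
      omega
    · push Not at hall
      obtain ⟨γ, hγ, hγn⟩ := hall
      obtain ⟨t, rfl⟩ := Multiset.exists_cons_of_mem hγ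
      have hγP := hsP γ hγ
      have hne : β + γ ≠ 0 := by
        intro h
        apply hPC.not_both β hβ
        rwa [← eq_neg_of_add_eq_zero_right h]
      have hroot : β + γ ∈ rootsC hC := by
        by_contra hn
        obtain ⟨m, hm⟩ := aux_nat_of_not_root hC (hPC.subset hγP) ht he hn hne
        exact hγn m hm
      refine ih (β + γ) t (by simpa using hs) (hPC.add_mem _ hβ _ hγP hroot)
        (fun δ hδ => hsP δ (Multiset.mem_cons_of_mem hδ)) ?_
      rw [← h0, Multiset.sum_cons, add_assoc]

lemma aux_not_neg_mem_closure {PC : Set (Module.Dual ℂ hC)} (hPC : IsPositiveSystemC hC PC)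
    {β : Module.Dual ℂ hC} (hβ : β ∈ PC) : -β ∉ AddSubmonoid.closure PC := by
  intro h
  obtain ⟨s, hs, hsum⟩ := AddSubmonoid.exists_multiset_of_mem_closure h
  exact aux_sum_ne_zero hC hPC _ β s rfl hβ hs (by rw [hsum]; simp)

/-- The Killing form is real on pairs of elements of `hC` on which all roots are real. -/
lemma aux_killing_real {x y : hC} (hx : ∀ χ ∈ rootsC hC, (χ x).im = 0)
    (hy : ∀ χ ∈ rootsC hC, (χ y).im = 0) : (killingForm ℂ gC x y).im = 0 := by
  have h1 : killingForm ℂ gC x y = LieModule.traceForm ℂ hC gC x y := rfl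
  have key : ∀ α ∈ hC.root, ∀ z : hC, (∀ χ ∈ rootsC hC, (χ z).im = 0) →
      ((α : hC → ℂ) z).im = 0 := by
    intro α hα z hz
    rw [← LieModule.Weight.toLinear_apply]
    refine hz _ ⟨?_, ?_⟩
    · intro h
      have : α.IsNonZero := by simpa using hα
      apply this
      funext H
      exact congrArg (fun ξ : Module.Dual ℂ hC => ξ H) h
    · obtain ⟨e, he, he0⟩ := α.exists_ne_zero
      exact ⟨e, fun H => LieAlgebra.IsKilling.lie_eq_smul_of_mem_rootSpace he H, he0⟩
  rw [h1, LieModule.traceForm_eq_sum_finrank_nsmul' ℂ hC gC]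
  simp only [LinearMap.coe_sum, Finset.sum_apply, Complex.im_sum]
  refine Finset.sum_eq_zero fun α hα => ?_
  have ha := key α hα x hx
  have hb := key α hα y hy
  simp [ha, hb]

end Aux1

section Aux2

lemma aux_decomp {g k p : Submodule ℝ gC} (hg : IsRealForm g) (hkp : IsCartanDecomposition g k p)
    (z : gC) : ∃ k1 ∈ k, ∃ p1 ∈ p, ∃ k2 ∈ k, ∃ p2 ∈ p,
      z = (k1 + p1) + Complex.I • (k2 + p2) := by
  obtain ⟨x, hx, y, hy, rfl⟩ := hg.spans z
  rw [← hkp.sup_eq] at hx hy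
  obtain ⟨k1, hk1, p1, hp1, rfl⟩ := Submodule.mem_sup.1 hx
  obtain ⟨k2, hk2, p2, hp2, rfl⟩ := Submodule.mem_sup.1 hy
  exact ⟨k1, hk1, p1, hp1, k2, hk2, p2, hp2, rfl⟩

lemma aux_ext {g k p : Submodule ℝ gC} (hg : IsRealForm g) (hkp : IsCartanDecomposition g k p)
    {f f' : gC →ₗ[ℂ] gC} (h1 : ∀ x ∈ k, f x = f' x) (h2 : ∀ x ∈ p, f x = f' x) (z : gC) :
    f z = f' z := by
  obtain ⟨k1, hk1, p1, hp1, k2, hk2, p2, hp2, rfl⟩ := aux_decomp hg hkp z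
  simp only [map_add, map_smul, h1 _ hk1, h1 _ hk2, h2 _ hp1, h2 _ hp2]

lemma aux_mem_span (k : Submodule ℝ gC) {z : gC} (hz : z ∈ Submodule.span ℂ (k : Set gC)) :
    ∃ x ∈ k, ∃ y ∈ k, z = x + Complex.I • y := by
  induction hz using Submodule.span_induction with
  | mem x hx => exact ⟨x, hx, 0, k.zero_mem, by simp⟩
  | zero => exact ⟨0, k.zero_mem, 0, k.zero_mem, by simp⟩
  | add x y _ _ hx hy =>
    obtain ⟨a, ha, b, hb, rfl⟩ := hx
    obtain ⟨c, hc, d, hd, rfl⟩ := hy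
    exact ⟨a + c, k.add_mem ha hc, b + d, k.add_mem hb hd, by rw [smul_add]; abel⟩
  | smul c x _ hx =>
    obtain ⟨a, ha, b, hb, rfl⟩ := hx
    refine ⟨c.re • a - c.im • b, k.sub_mem (k.smul_mem _ ha) (k.smul_mem _ hb),
      c.im • a + c.re • b, k.add_mem (k.smul_mem _ ha) (k.smul_mem _ hb), ?_⟩
    have h1 : ∀ (r : ℝ) (v : gC), r • v = (r : ℂ) • v := fun r v => rfl
    simp only [h1]
    have hI : Complex.I * Complex.I = -1 := Complex.I_mul_I
    conv_lhs => rw [← Complex.re_add_im c]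
    match_scalars
    · ring
    · linear_combination (c.im : ℂ) * hI

lemma aux_theta {g k p : Submodule ℝ gC} (hg : IsRealForm g)
    (hkp : IsCartanDecomposition g k p) :
    ∃ θ : gC ≃ₗ⁅ℂ⁆ gC, (∀ x ∈ k, θ x = x) ∧ (∀ x ∈ p, θ x = -x) ∧ ∀ x, θ (θ x) = x := by
  have hc : IsCompl (Submodule.span ℂ (k : Set gC)) (Submodule.span ℂ (p : Set gC)) := by
    constructor
    · rw [Submodule.disjoint_def]
      intro z hz1 hz2
      obtain ⟨k1, hk1, k2, hk2, rfl⟩ := aux_mem_span k hz1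
      obtain ⟨p1, hp1, p2, hp2, h⟩ := aux_mem_span p hz2
      have h1 : Complex.I • (k2 - p2) = p1 - k1 := by
        rw [smul_sub, sub_eq_sub_iff_add_eq_add, add_comm, h]
      have h2 : k2 - p2 = 0 := by
        refine hg.indep _ (g.sub_mem (hkp.k_le hk2) (hkp.p_le hp2)) ?_
        rw [h1]
        exact g.sub_mem (hkp.p_le hp1) (hkp.k_le hk1)
      rw [h2, smul_zero] at h1
      have e1 : k2 = p2 := sub_eq_zero.1 h2
      have e2 : p1 = k1 := sub_eq_zero.1 h1.symm
      have z1 : k1 ∈ k ⊓ p := ⟨hk1, e2 ▸ hp1⟩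
      have z2 : k2 ∈ k ⊓ p := ⟨hk2, e1 ▸ hp2⟩
      rw [hkp.inf_eq, Submodule.mem_bot] at z1 z2
      simp [z1, z2]
    · rw [codisjoint_iff, eq_top_iff]
      intro z _
      obtain ⟨k1, hk1, p1, hp1, k2, hk2, p2, hp2, rfl⟩ := aux_decomp hg hkp z
      have hK : ∀ x ∈ k, x ∈ Submodule.span ℂ (k : Set gC) ⊔ Submodule.span ℂ (p : Set gC) :=
        fun x hx => Submodule.mem_sup_left (Submodule.subset_span hx)
      have hP : ∀ x ∈ p, x ∈ Submodule.span ℂ (k : Set gC) ⊔ Submodule.span ℂ (p : Set gC) :=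
        fun x hx => Submodule.mem_sup_right (Submodule.subset_span hx)
      exact add_mem (add_mem (hK _ hk1) (hP _ hp1))
        (Submodule.smul_mem _ _ (add_mem (hK _ hk2) (hP _ hp2)))
  let θ : gC →ₗ[ℂ] gC := LinearMap.ofIsCompl hc (Submodule.subtype _) (-(Submodule.subtype _))
  have hk : ∀ x ∈ k, θ x = x := fun x hx =>
    LinearMap.ofIsCompl_apply_left hc (⟨x, Submodule.subset_span hx⟩ : Submodule.span ℂ (k : Set gC))
  have hp : ∀ x ∈ p, θ x = -x := fun x hx =>
    LinearMap.ofIsCompl_apply_right hc (⟨x, Submodule.subset_span hx⟩ : Submodule.span ℂ (p : Set gC))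
  have hinv : ∀ x, θ (θ x) = x := by
    intro x
    refine aux_ext hg hkp (f := θ ∘ₗ θ) (f' := LinearMap.id) ?_ ?_ x
    · intro y hy; simp [hk y hy]
    · intro y hy; simp [hp y hy]
  have hlie1 : ∀ x, (x ∈ k ∨ x ∈ p) → ∀ y, θ ⁅x, y⁆ = ⁅θ x, θ y⁆ := by
    intro x hx y
    refine aux_ext hg hkp (f := θ ∘ₗ (ad ℂ gC x : gC →ₗ[ℂ] gC))
      (f' := (ad ℂ gC (θ x) : gC →ₗ[ℂ] gC) ∘ₗ θ) ?_ ?_ y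
    · intro y hy
      rcases hx with hx | hx
      · simp [hk x hx, hk y hy, hk _ (hkp.lie_kk x hx y hy)]
      · have : ⁅x, y⁆ ∈ p := by
          rw [← lie_skew]; exact p.neg_mem (hkp.lie_kp y hy x hx)
        simp [hp x hx, hk y hy, hp _ this]
    · intro y hy
      rcases hx with hx | hx
      · simp [hk x hx, hp y hy, hp _ (hkp.lie_kp x hx y hy)]
      · simp [hp x hx, hp y hy, hk _ (hkp.lie_pp x hx y hy)]
  have hlie : ∀ x y, θ ⁅x, y⁆ = ⁅θ x, θ y⁆ := by
    intro x y
    rw [← lie_skew, map_neg, ← lie_skew (θ x)]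
    congr 1
    refine aux_ext hg hkp (f := θ ∘ₗ (ad ℂ gC y : gC →ₗ[ℂ] gC))
      (f' := (ad ℂ gC (θ y) : gC →ₗ[ℂ] gC) ∘ₗ θ) ?_ ?_ x
    · intro z hz
      simp only [LinearMap.comp_apply, ad_apply]
      rw [← lie_skew, map_neg, hlie1 z (Or.inl hz), lie_skew]
    · intro z hz
      simp only [LinearMap.comp_apply, ad_apply]
      rw [← lie_skew, map_neg, hlie1 z (Or.inr hz), lie_skew]
  let e : gC ≃ₗ⁅ℂ⁆ gC :=
    { θ with
      map_lie' := fun {x y} => hlie x y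
      invFun := θ
      left_inv := hinv
      right_inv := hinv }
  exact ⟨e, hk, hp, hinv⟩

lemma aux_sigma_ne {g k p : Submodule ℝ gC} (hg : IsRealForm g)
    (hkp : IsCartanDecomposition g k p) (θ : gC ≃ₗ⁅ℂ⁆ gC) (hk : ∀ x ∈ k, θ x = x)
    (hp : ∀ x ∈ p, θ x = -x) (τ : gC →ₗ[ℝ] gC)
    (hτconj : ∀ (c : ℂ) (x : gC), τ (c • x) = (starRingEnd ℂ) c • τ x)
    (hτfix : ∀ x : gC, τ x = x ↔ x ∈ g) {X : gC} (hX : X ≠ 0) :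
    killingForm ℂ gC X (θ (τ X)) ≠ 0 := by
  obtain ⟨k1, hk1, p1, hp1, k2, hk2, p2, hp2, rfl⟩ := aux_decomp hg hkp X
  have hkp0 : ∀ x ∈ k, ∀ y ∈ p, killingForm ℂ gC x y = 0 := by
    intro x hx y hy
    have := killingForm_of_equiv_apply θ x y
    rw [hk x hx, hp y hy, map_neg] at this
    exact self_eq_neg.1 this.symm
  have hpk0 : ∀ x ∈ k, ∀ y ∈ p, killingForm ℂ gC y x = 0 := fun x hx y hy => by
    rw [LieModule.traceForm_comm]; exact hkp0 x hx y hy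
  have t1 : ∀ x ∈ k, τ x = x := fun x hx => (hτfix x).2 (hkp.k_le hx)
  have t2 : ∀ x ∈ p, τ x = x := fun x hx => (hτfix x).2 (hkp.p_le hx)
  have key : killingForm ℂ gC ((k1 + p1) + Complex.I • (k2 + p2))
      (θ (τ ((k1 + p1) + Complex.I • (k2 + p2)))) =
      killingForm ℂ gC k1 k1 + killingForm ℂ gC k2 k2 - killingForm ℂ gC p1 p1
        - killingForm ℂ gC p2 p2 := by
    rw [map_add τ, hτconj, map_add τ, map_add τ, t1 _ hk1, t1 _ hk2, t2 _ hp1, t2 _ hp2]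
    simp only [map_add, map_smul, hk _ hk1, hk _ hk2, hp _ hp1, hp _ hp2, LinearMap.add_apply,
      LinearMap.smul_apply, map_neg, hkp0 _ hk1 _ hp1, hkp0 _ hk1 _ hp2, hkp0 _ hk2 _ hp1,
      hkp0 _ hk2 _ hp2, hpk0 _ hk1 _ hp1, hpk0 _ hk1 _ hp2, hpk0 _ hk2 _ hp1,
      hpk0 _ hk2 _ hp2, smul_eq_mul, Complex.conj_I, LieModule.traceForm_comm ℂ gC gC k2 k1,
      LieModule.traceForm_comm ℂ gC gC p2 p1]
    linear_combination (killingForm ℂ gC p2 p2 - killingForm ℂ gC k2 k2) * Complex.I_mul_I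
  rw [key]
  intro h
  have hre := congrArg Complex.re h
  simp only [Complex.sub_re, Complex.add_re, Complex.zero_re] at hre
  have nk : ∀ x ∈ k, (killingForm ℂ gC x x).re ≤ 0 ∧ (x ≠ 0 → (killingForm ℂ gC x x).re < 0) := by
    intro x hx
    refine ⟨?_, hkp.killing_neg x hx⟩
    by_cases h0 : x = 0
    · simp [h0]
    · exact (hkp.killing_neg x hx h0).le
  have np : ∀ x ∈ p, 0 ≤ (killingForm ℂ gC x x).re ∧ (x ≠ 0 → 0 < (killingForm ℂ gC x x).re) := by
    intro x hx
    refine ⟨?_, hkp.killing_pos x hx⟩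
    by_cases h0 : x = 0
    · simp [h0]
    · exact (hkp.killing_pos x hx h0).le
  have a1 := (nk k1 hk1).1
  have a2 := (nk k2 hk2).1
  have a3 := (np p1 hp1).1
  have a4 := (np p2 hp2).1
  have b1 : k1 = 0 := by
    by_contra h0; have := (nk k1 hk1).2 h0; linarith
  have b2 : k2 = 0 := by
    by_contra h0; have := (nk k2 hk2).2 h0; linarith
  have b3 : p1 = 0 := by
    by_contra h0; have := (np p1 hp1).2 h0; linarith
  have b4 : p2 = 0 := by
    by_contra h0; have := (np p2 hp2).2 h0; linarith
  exact hX (by simp [b1, b2, b3, b4])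

end Aux2

/-- **Lemma 5.3 (Okuda).** Let `φ` be the highest root of `Δ⁺(gC,hC)`, `τ` the
conjugation of `gC` with respect to `g` (inducing `τ*` on `h*`), and
`lam = φ|_a` the highest restricted root.  If `φ` is not a real root, then
`⟨φ, τ*φ⟩ = 0` and consequently `⟨φ,φ⟩ = 2⟨lam,lam⟩`.  In terms of the Killing-dual
vectors `tphi` of `φ` (so that `τ tphi` is the dual of `τ*φ`) and `tlam` of `lam`,
this reads `κ(tphi, τ tphi) = 0` and `κ(tphi,tphi) = 2 κ(tlam,tlam)`. -/
theorem highest_root_orthogonal_to_conjugate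
    {gC : Type*} [LieRing gC] [LieAlgebra ℂ gC] [FiniteDimensional ℂ gC]
    [LieAlgebra.IsSimple ℂ gC]
    (g k p a : Submodule ℝ gC) (hg : IsRealForm g)
    (hkp : IsCartanDecomposition g k p) (hnoncompact : p ≠ ⊥)
    (ha : IsMaximalAbelianIn a p)
    (P : Set (Module.Dual ℝ a)) (hP : IsPositiveSystem g a P)
    (lam : Module.Dual ℝ a) (hlam : IsHighestRestrictedRoot g a P lam)
    (hC : LieSubalgebra ℂ gC) [hC.IsCartanSubalgebra] (hah : ∀ x ∈ a, x ∈ hC)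
    (hspan : Submodule.span ℂ
        ({x : gC | x ∈ hC ∧ Complex.I • x ∈ k} ∪ (a : Set gC)) = hC.toSubmodule)
    (PC : Set (Module.Dual ℂ hC)) (hPC : IsPositiveSystemC hC PC)
    (hcompat : CompatiblePositiveSystems hC a hah PC P)
    (φ : Module.Dual ℂ hC) (hφ : IsHighestRootC hC PC φ)
    (τ : gC →ₗ[ℝ] gC)
    (hτinv : ∀ x, τ (τ x) = x)
    (hτconj : ∀ (c : ℂ) (x : gC), τ (c • x) = (starRingEnd ℂ) c • τ x)
    (hτfix : ∀ x : gC, τ x = x ↔ x ∈ g)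
    (hτlie : ∀ x y : gC, τ ⁅x, y⁆ = ⁅τ x, τ y⁆)
    (tlam : gC) (htlama : tlam ∈ a)
    (htlamdual : ∀ A' : a, killingForm ℂ gC tlam A' = ((lam A' : ℝ) : ℂ))
    (tphi : gC) (htphi : tphi ∈ hC)
    (htphidual : ∀ H : hC, killingForm ℂ gC tphi H = φ H)
    (hres : ∀ x : gC, ∀ hx : x ∈ a, φ ⟨x, hah x hx⟩ = ((lam ⟨x, hx⟩ : ℝ) : ℂ))
    (hnotreal : ¬IsRealRootWRT hC k φ) :
    killingForm ℂ gC tphi (τ tphi) = 0 ∧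
    killingForm ℂ gC tphi tphi = 2 * killingForm ℂ gC tlam tlam := by
  obtain ⟨θ, hθk, hθp, hθθ⟩ := aux_theta hg hkp
  have hσne := fun {X : gC} (hX : X ≠ 0) =>
    aux_sigma_ne hg hkp θ hθk hθp τ hτconj hτfix hX
  have hκθ : ∀ x y, killingForm ℂ gC (θ x) (θ y) = killingForm ℂ gC x y :=
    killingForm_of_equiv_apply θ
  have hκθ' : ∀ x y, killingForm ℂ gC (θ x) y = killingForm ℂ gC x (θ y) := by
    intro x y
    rw [← hκθ x (θ y), hθθ]
  have hI2 : ∀ x : gC, Complex.I • Complex.I • x = -x := fun x => by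
    rw [smul_smul, Complex.I_mul_I, neg_one_smul]
  -- behaviour of `θ` on the two pieces of `hC`
  have hθt : ∀ x : gC, Complex.I • x ∈ k → θ x = x := by
    intro x hx
    have h1 := hθk _ hx
    rw [map_smul] at h1
    exact smul_right_injective gC Complex.I_ne_zero h1
  have hθa : ∀ x ∈ a, θ x = -x := fun x hx => hθp x (ha.le hx)
  have hτt : ∀ x : gC, Complex.I • x ∈ k → τ x = -x := by
    intro x hx
    have h1 := (hτfix _).2 (hkp.k_le hx)
    rw [hτconj, Complex.conj_I, neg_smul, ← smul_neg] at h1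
    have h2 := smul_right_injective gC Complex.I_ne_zero h1
    exact neg_eq_iff_eq_neg.1 h2
  have hτa : ∀ x ∈ a, τ x = x := fun x hx => (hτfix x).2 (hkp.p_le (ha.le hx))
  -- induction principle for `hC`
  have hind : ∀ (Q : gC → Prop), (∀ x ∈ hC, Complex.I • x ∈ k → Q x) → (∀ x ∈ a, Q x) →
      (∀ x y, Q x → Q y → Q (x + y)) → (∀ (c : ℂ) x, Q x → Q (c • x)) → ∀ x ∈ hC, Q x := by
    intro Q h1 h2 h3 h4 x hx
    have hx' : x ∈ hC.toSubmodule := hx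
    rw [← hspan] at hx'
    induction hx' using Submodule.span_induction with
    | mem x hxm =>
      rcases hxm with hx | hx
      · exact h1 x hx.1 hx.2
      · exact h2 x hx
    | zero => simpa using h4 0 0 (h2 0 a.zero_mem)
    | add x y hx1 hy1 hx2 hy2 =>
      rw [hspan] at hx1 hy1
      exact h3 _ _ (hx2 hx1) (hy2 hy1)
    | smul c x hx1 hx2 =>
      rw [hspan] at hx1
      exact h4 _ _ (hx2 hx1)
  have hθC : ∀ x ∈ hC, θ x ∈ hC := by
    refine hind _ ?_ ?_ ?_ ?_
    · intro x hx hxk; rwa [hθt x hxk]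
    · intro x hx; rw [hθa x hx]; exact neg_mem (hah x hx)
    · intro x y hx hy; rw [map_add]; exact add_mem hx hy
    · intro c x hx; rw [map_smul]; exact hC.smul_mem c hx
  -- roots are real on the real part of `hC`
  have hreal : ∀ H : hC, θ (τ H) = -(H : gC) → ∀ χ ∈ rootsC hC, (χ H).im = 0 := by
    rintro H hH χ ⟨-, X, hX, hX0⟩
    have h1 : ⁅(H : gC), X⁆ = χ H • X := hX H
    have h2 : ⁅(H : gC), θ (τ X)⁆ = -((starRingEnd ℂ) (χ H) • θ (τ X)) := by
      have := congrArg (fun z => θ (τ z)) h1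
      simp only [hτlie, hτconj, LieEquiv.map_lie, map_smul, hH, neg_lie] at this
      rw [← this, neg_neg]
    have h3 := LieModule.traceForm_apply_lie_apply' ℂ gC gC (H : gC) X (θ (τ X))
    rw [h1, h2, map_neg, neg_neg, map_smul, map_smul, LinearMap.smul_apply] at h3
    have h4 : χ H = (starRingEnd ℂ) (χ H) :=
      mul_right_cancel₀ (hσne hX0) (by simpa only [smul_eq_mul] using h3)
    exact Complex.conj_eq_iff_im.1 h4.symm
  have hσt : ∀ x : gC, Complex.I • x ∈ k → θ (τ x) = -x := fun x hx => by
    rw [hτt x hx, map_neg, hθt x hx]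
  have hσa : ∀ x ∈ a, θ (τ x) = -x := fun x hx => by rw [hτa x hx, hθa x hx]
  -- decomposition of `hC` into real and imaginary part
  have hdec : ∀ x ∈ hC, ∃ r ∈ hC, ∃ s ∈ hC, θ (τ r) = -r ∧ θ (τ s) = -s ∧
      x = r + Complex.I • s := by
    refine hind _ ?_ ?_ ?_ ?_
    · intro x hx hxk
      exact ⟨x, hx, 0, hC.zero_mem, hσt x hxk, by simp, by simp⟩
    · intro x hx
      exact ⟨x, hah x hx, 0, hC.zero_mem, hσa x hx, by simp, by simp⟩
    · rintro x y ⟨r, hr, s, hs, h1, h2, rfl⟩ ⟨r', hr', s', hs', h1', h2', rfl⟩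
      exact ⟨r + r', add_mem hr hr', s + s', add_mem hs hs', by rw [map_add, map_add, h1, h1']; abel,
        by rw [map_add, map_add, h2, h2']; abel, by rw [smul_add]; abel⟩
    · rintro c x ⟨r, hr, s, hs, h1, h2, rfl⟩
      have hsm : ∀ (q : ℝ) (v : gC), θ (τ v) = -v →
          θ (τ ((q : ℂ) • v)) = -((q : ℂ) • v) := by
        intro q v hv
        rw [hτconj, map_smul, hv, Complex.conj_ofReal, smul_neg]
      refine ⟨(c.re : ℂ) • r - (c.im : ℂ) • s, sub_mem (hC.smul_mem _ hr) (hC.smul_mem _ hs),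
        (c.im : ℂ) • r + (c.re : ℂ) • s, add_mem (hC.smul_mem _ hr) (hC.smul_mem _ hs), ?_, ?_, ?_⟩
      · rw [map_sub, map_sub, hsm _ _ h1, hsm _ _ h2]; abel
      · rw [map_add, map_add, hsm _ _ h1, hsm _ _ h2]; abel
      · have hI : Complex.I * Complex.I = -1 := Complex.I_mul_I
        conv_lhs => rw [← Complex.re_add_im c]
        match_scalars
        · ring
        · linear_combination (c.im : ℂ) * hI
  have hφroot : φ ∈ rootsC hC := hPC.subset hφ.1
  -- `tphi` lies in the real part
  have htphiσ : θ (τ tphi) = -tphi := by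
    obtain ⟨r, hr, s, hs, h1, h2, h3⟩ := hdec tphi htphi
    have hz : ∀ y (hy : y ∈ hC), θ (τ y) = -y → killingForm ℂ gC s y = 0 := by
      intro y hy hyσ
      have e1 := htphidual ⟨y, hy⟩
      have e2 := hreal ⟨y, hy⟩ hyσ φ hφroot
      have e3 := aux_killing_real hC (x := ⟨r, hr⟩) (y := ⟨y, hy⟩) (hreal ⟨r, hr⟩ h1)
        (hreal ⟨y, hy⟩ hyσ)
      have e4 := aux_killing_real hC (x := ⟨s, hs⟩) (y := ⟨y, hy⟩) (hreal ⟨s, hs⟩ h2)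
        (hreal ⟨y, hy⟩ hyσ)
      simp only at e1 e3 e4
      rw [← e1, h3, map_add, map_smul, LinearMap.add_apply, LinearMap.smul_apply, smul_eq_mul,
        Complex.add_im, e3, Complex.I_mul_im, zero_add] at e2
      exact Complex.ext e2 e4
    have hs0 : s = 0 := by
      refine aux_nondeg hC hs ?_
      refine hind _ ?_ ?_ ?_ ?_
      · intro y hy hyk; exact hz y hy (hσt y hyk)
      · intro y hy; exact hz y (hah y hy) (hσa y hy)
      · intro x y hx hy; rw [map_add, hx, hy, add_zero]
      · intro c x hx; rw [map_smul, hx, smul_zero]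
    rw [h3, hs0, smul_zero, add_zero, h1]
  have hτtphi : τ tphi = -θ tphi := by
    have := congrArg θ htphiσ
    rwa [hθθ, map_neg] at this
  -- the conjugate root
  let ψ : Module.Dual ℂ hC :=
    { toFun := fun H => -φ ⟨θ H, hθC H H.2⟩
      map_add' := by
        intro x y
        rw [← neg_add, ← map_add]
        congr 2
        ext
        simp
      map_smul' := by
        intro c x
        rw [RingHom.id_apply, smul_neg, ← map_smul]
        congr 2
        ext
        simp }
  have hψ : ∀ H : hC, ψ H = -φ ⟨θ H, hθC H H.2⟩ := fun _ => rfl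
  have hψa : ∀ x (hx : x ∈ a), ψ ⟨x, hah x hx⟩ = φ ⟨x, hah x hx⟩ := by
    intro x hx
    rw [hψ, ← map_neg]
    congr 1
    ext
    simp [hθa x hx]
  have hψt : ∀ x (hx : x ∈ hC), Complex.I • x ∈ k → ψ ⟨x, hx⟩ = -φ ⟨x, hx⟩ := by
    intro x hx hxk
    rw [hψ]
    congr 2
    ext
    simp [hθt x hxk]
  obtain ⟨x0, hx0, hx0k, hφx0⟩ : ∃ x, ∃ hx : x ∈ hC, Complex.I • x ∈ k ∧ φ ⟨x, hx⟩ ≠ 0 := by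
    unfold IsRealRootWRT at hnotreal
    push Not at hnotreal
    exact hnotreal
  have hlam0 : lam ≠ 0 := (hP.subset hlam.1).1
  obtain ⟨y0, hy0⟩ : ∃ y : a, lam y ≠ 0 := by
    by_contra h
    push Not at h
    exact hlam0 (LinearMap.ext h)
  have hφy0 : φ ⟨y0, hah y0 y0.2⟩ ≠ 0 := by
    rw [hres y0 y0.2]
    exact_mod_cast hy0
  -- root vectors of `-ψ`
  have hθroot : ∀ X ∈ rootSpaceC hC φ, θ X ∈ rootSpaceC hC (-ψ) := by
    intro X hX H
    have h1 := hX ⟨θ H, hθC H H.2⟩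
    have h2 := congrArg θ h1
    rw [LieEquiv.map_lie, map_smul] at h2
    simp only [hθθ] at h2
    rw [h2, LinearMap.neg_apply, hψ, neg_neg]
  -- `ψ` is a positive root
  have hψP : ψ ∈ PC := by
    have hneg : -ψ ∈ rootsC hC := by
      obtain ⟨-, X, hX, hX0⟩ := hφroot
      refine ⟨?_, θ X, hθroot X hX, ?_⟩
      · intro h
        apply hφy0
        rw [← hψa y0 y0.2, neg_eq_zero.1 h]; rfl
      · intro h
        apply hX0
        rw [← hθθ X, h, map_zero]
    rcases hPC.total _ hneg with h | h
    · exfalso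
      have hnv : ¬VanishesOnA hC a hah (-ψ) := by
        intro hv
        have := hv y0 y0.2
        rw [LinearMap.neg_apply, hψa y0 y0.2, neg_eq_zero] at this
        exact hφy0 this
      obtain ⟨ξ, hξ, hξe⟩ := hcompat _ h hnv
      have hξl : -lam = ξ := by
        ext y
        have := hξe y y.2
        rw [LinearMap.neg_apply, hψa y y.2, hres y y.2] at this
        rw [LinearMap.neg_apply]
        exact_mod_cast this
      exact hP.not_both lam hlam.1 (hξl ▸ hξ)
    · rwa [neg_neg] at h
  obtain ⟨h, e, f, ht, he, he0, hφh, c, hc⟩ := aux_sl2 hC hφroot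
  -- first inequality
  obtain ⟨n, hn⟩ : ∃ n : ℕ, ψ h = n := by
    refine aux_nat_of_not_root hC (hPC.subset hψP) ht he ?_ ?_
    · intro hr
      have h1 := hφ.2 _ hr
      rw [sub_add_cancel_left] at h1
      exact aux_not_neg_mem_closure hC hPC hψP h1
    · intro h0
      have h1 := congrArg (fun ξ : Module.Dual ℂ hC => ξ ⟨y0, hah y0 y0.2⟩) h0
      simp only [LinearMap.add_apply, LinearMap.zero_apply, hψa y0 y0.2] at h1
      exact hφy0 (by linear_combination h1 / 2)
  -- second inequality
  obtain ⟨m, hm⟩ : ∃ m : ℕ, (-ψ) h = m := by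
    have hθe0 : θ e ≠ 0 := by
      intro h
      apply he0
      rw [← hθθ e, h, map_zero]
    refine aux_nat ht hθe0 (hθroot e he h) ?_
    have hv : ⁅e, θ e⁆ ∈ rootSpaceC hC (φ + -ψ) := aux_lie_add hC he (hθroot e he)
    have hθv : θ ⁅e, θ e⁆ = -⁅e, θ e⁆ := by
      rw [LieEquiv.map_lie, hθθ, lie_skew]
    generalize ⁅e, θ e⁆ = v at hv hθv
    obtain ⟨k1, hk1, p1, hp1, k2, hk2, p2, hp2, rfl⟩ := aux_decomp hg hkp v
    have hk0 : k1 + Complex.I • k2 = 0 := by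
      simp only [map_add, map_smul, hθk _ hk1, hθk _ hk2, hθp _ hp1, hθp _ hp2] at hθv
      have h2 : (2 : ℂ) • (k1 + Complex.I • k2) = 0 := by
        rw [eq_neg_iff_add_eq_zero] at hθv
        rw [← hθv]
        module
      exact (smul_eq_zero.1 h2).resolve_left two_ne_zero
    have hvp : k1 + p1 + Complex.I • (k2 + p2) = p1 + Complex.I • p2 := by
      rw [← zero_add (p1 + Complex.I • p2), ← hk0]
      module
    rw [hvp] at hv ⊢
    have hcent : ∀ y ∈ a, ⁅p1, y⁆ = 0 ∧ ⁅p2, y⁆ = 0 := by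
      intro y hy
      have h1 := hv ⟨y, hah y hy⟩
      rw [LinearMap.add_apply, LinearMap.neg_apply, hψa y hy, add_neg_cancel, zero_smul] at h1
      simp only [lie_add, lie_smul] at h1
      have hyg := hkp.p_le (ha.le hy)
      have g1 := hg.lie_mem y hyg p1 (hkp.p_le hp1)
      have g2 := hg.lie_mem y hyg p2 (hkp.p_le hp2)
      have z2 : ⁅y, p2⁆ = 0 := by
        refine hg.indep _ g2 ?_
        rw [eq_neg_of_add_eq_zero_right h1]
        exact g.neg_mem g1
      rw [z2, smul_zero, add_zero] at h1
      rw [← lie_skew, ← lie_skew p2 y, h1, z2, neg_zero]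
      exact ⟨rfl, rfl⟩
    have hp1a := ha.maximal p1 hp1 fun y hy => (hcent y hy).1
    have hp2a := ha.maximal p2 hp2 fun y hy => (hcent y hy).2
    have hvC : p1 + Complex.I • p2 ∈ hC := add_mem (hah _ hp1a) (hC.smul_mem _ (hah _ hp2a))
    have h1 := hv ⟨x0, hx0⟩
    have h2 : ⁅x0, p1 + Complex.I • p2⁆ = 0 :=
      congrArg Subtype.val (trivial_lie_zero hC hC ⟨x0, hx0⟩ ⟨_, hvC⟩)
    rw [h2, LinearMap.add_apply, LinearMap.neg_apply, hψt x0 hx0 hx0k, neg_neg] at h1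
    refine (smul_eq_zero.1 h1.symm).resolve_left fun h3 => hφx0 ?_
    linear_combination h3 / 2
  have hψh : ψ h = 0 := by
    rw [LinearMap.neg_apply, hn] at hm
    have h1 : ((n + m : ℕ) : ℂ) = 0 := by
      push_cast
      linear_combination -hm
    have h2 : n = 0 := by
      have := Nat.cast_eq_zero.1 h1
      omega
    rw [hn, h2, Nat.cast_zero]
  have hh : (h : gC) = c • tphi := by
    rw [← sub_eq_zero]
    refine aux_nondeg hC (sub_mem h.2 (hC.smul_mem _ htphi)) fun y hy => ?_
    rw [map_sub, map_smul, LinearMap.sub_apply, LinearMap.smul_apply]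
    have h1 := hc ⟨y, hy⟩
    have h2 := htphidual ⟨y, hy⟩
    simp only at h1 h2
    rw [h1, h2, smul_eq_mul, sub_self]
  have hc0 : c ≠ 0 := by
    rintro rfl
    exact ht.h_ne_zero (by rw [hh, zero_smul])
  have horth : killingForm ℂ gC tphi (θ tphi) = 0 := by
    have h1 := htphidual ⟨θ tphi, hθC _ htphi⟩
    have h2 : ψ h = c * ψ ⟨tphi, htphi⟩ := by
      rw [← smul_eq_mul, ← map_smul]
      congr 1
      ext
      exact hh
    rw [hψh, hψ] at h2
    rw [h1]
    exact neg_eq_zero.1 ((mul_eq_zero.1 h2.symm).resolve_left hc0)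
  refine ⟨by rw [hτtphi, map_neg, horth, neg_zero], ?_⟩
  -- `tphi - θ tphi = 2 tlam`
  have h2lam : tphi - θ tphi = (2 : ℂ) • tlam := by
    rw [← sub_eq_zero]
    refine aux_nondeg hC (sub_mem (sub_mem htphi (hθC _ htphi)) (hC.smul_mem _ (hah _ htlama))) ?_
    refine hind _ ?_ ?_ ?_ ?_
    · intro y hy hyk
      have e1 : killingForm ℂ gC tlam y = 0 := by
        have := hκθ tlam y
        rw [hθa _ htlama, hθt y hyk, map_neg, LinearMap.neg_apply] at this
        exact self_eq_neg.1 this.symm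
      rw [map_sub, map_sub, map_smul, LinearMap.sub_apply, LinearMap.sub_apply,
        LinearMap.smul_apply, hκθ', hθt y hyk, e1]
      simp
    · intro y hy
      have e1 := htlamdual ⟨y, hy⟩
      have e2 := htphidual ⟨y, hah y hy⟩
      rw [hres y hy] at e2
      simp only at e1 e2
      rw [map_sub, map_sub, map_smul, LinearMap.sub_apply, LinearMap.sub_apply,
        LinearMap.smul_apply, hκθ', hθa y hy, map_neg, e1, e2, smul_eq_mul]
      ring
    · intro x y hx hy; rw [map_add, hx, hy, add_zero]
    · intro c x hx; rw [map_smul, hx, smul_zero]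
  have hfin : killingForm ℂ gC (tphi - θ tphi) (tphi - θ tphi) =
      killingForm ℂ gC ((2 : ℂ) • tlam) ((2 : ℂ) • tlam) := by rw [h2lam]
  simp only [map_sub, map_smul, LinearMap.sub_apply, LinearMap.smul_apply, hκθ, horth,
    smul_eq_mul] at hfin
  rw [hκθ', horth] at hfin
  linear_combination hfin / 2

end SmallestOrbitPaper
end

section
/- Let g be a real form of a complex semisimple Lie algebra g_C, with Satake diagram S on the simple roots Π of Δ+(g_C,h_C). Then the set {H_α : α a black node of S} ∪ {H_α − H_β : α, β joined by an arrow in S}, where H_α denotes the coroot of the simple root α, is a basis of the real vector space √−1 t. -/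
/-!
Common definitions: a complex simple Lie algebra `gC`, real forms, Cartan decompositions,
restricted roots, inner automorphism groups, adjoint orbits and the closure ordering.
-/

open LieAlgebra Set

namespace SatakeAux
open RootPairing Set

variable {ι R M N : Type*} [Finite ι] [Field R] [CharZero R] [AddCommGroup M] [Module R M]
  [AddCommGroup N] [Module R N] (P : RootPairing ι R M N) [P.IsRootSystem]
  [P.IsCrystallographic] [P.IsReduced]

theorem exists_reflected_base (b : P.Base) (j : ι) :
    ∃ b' : P.Base, ∀ i, b'.IsPos i ↔ b.IsPos (P.reflectionPerm j i) := by
  classical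
  have himg : P.root '' (P.reflectionPerm j '' (b.support : Set ι))
      = (P.reflection j) '' (P.root '' b.support) := by
    simp only [← image_comp]
    apply image_congr
    intro a _
    simp [P.root_reflectionPerm]
  have hcl : ∀ x, x ∈ AddSubmonoid.closure (P.root '' b.support) →
      P.reflection j x ∈ AddSubmonoid.closure (P.root '' (P.reflectionPerm j '' (b.support : Set ι))) := by
    intro x hx
    rw [himg]
    have := AddSubmonoid.mem_map_of_mem (P.reflection j).toLinearMap.toAddMonoidHom hx
    rw [AddMonoidHom.map_mclosure] at this
    exact this
  have hli : LinearIndepOn R P.root (P.reflectionPerm j '' (b.support : Set ι)) := by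
    rw [linearIndepOn_iff_image P.root.injective.injOn, himg]
    have h1 : LinearIndepOn R id (P.root '' b.support) :=
      (linearIndepOn_iff_image P.root.injective.injOn).1 b.linearIndepOn_root
    have := h1.image (f := (P.reflection j).toLinearMap) (by simp)
    exact this
  let b' : P.Base := Base.mk' P (P.reflectionPerm j '' (b.support : Set ι)) hli (by
    intro i
    have h1 : P.root i = P.reflection j (P.root (P.reflectionPerm j i)) := by
      rw [← P.root_reflectionPerm, P.reflectionPerm_self]
    rcases b.root_mem_or_neg_mem (P.reflectionPerm j i) with h | h
    · left; rw [h1]; exact hcl _ h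
    · right; rw [h1, ← map_neg]; exact hcl _ h)
  have hs : b'.support = b.support.image (P.reflectionPerm j) := by
    ext x; simp [b', Base.mk']
  refine ⟨b', fun i => ?_⟩
  obtain ⟨f, -, -, hf⟩ := b.exists_root_eq_sum_int (P.reflectionPerm j i)
  have hinj : Set.InjOn (P.reflectionPerm j) (b.support : Set ι) :=
    (P.reflectionPerm j).injective.injOn
  have h2 : P.root i = ∑ l ∈ b'.support, f (P.reflectionPerm j l) • P.root l := by
    rw [hs, Finset.sum_image hinj]
    have h1 : P.root i = P.reflection j (P.root (P.reflectionPerm j i)) := by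
      rw [← P.root_reflectionPerm, P.reflectionPerm_self]
    rw [h1, hf, map_sum]
    refine Finset.sum_congr rfl fun l _ => ?_
    rw [map_zsmul, ← P.root_reflectionPerm, P.reflectionPerm_self]
  rw [Base.isPos_iff, Base.isPos_iff, Base.height_eq_sum hf, Base.height_eq_sum h2, hs,
    Finset.sum_image hinj]
  simp

/-- A closed positive subset is the set of positive roots of a base. -/
theorem exists_base_of_positive (S : Set ι)
    (htot : ∀ i j, P.root j = - P.root i → i ∈ S ∨ j ∈ S)
    (hnb : ∀ i j, P.root j = - P.root i → i ∈ S → j ∉ S)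
    (hadd : ∀ i j k, i ∈ S → j ∈ S → P.root k = P.root i + P.root j → k ∈ S) :
    ∃ b : P.Base, ∀ i, b.IsPos i ↔ i ∈ S := by
  classical
  let := P.indexNeg
  have hneg : ∀ i, P.root (-i) = - P.root i := by intro i; simp
  suffices H : ∀ n : ℕ, ∀ b : P.Base, ({i | b.IsPos i ∧ i ∉ S} : Set ι).ncard = n →
      ∃ b : P.Base, ∀ i, b.IsPos i ↔ i ∈ S by
    obtain ⟨b⟩ := P.nonempty_base
    exact H _ b rfl
  intro n
  induction n using Nat.strong_induction_on with
  | _ n ih =>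
    intro b hb
    by_cases hsupp : ∀ i ∈ b.support, i ∈ S
    · refine ⟨b, ?_⟩
      have h1 : ∀ i, b.IsPos i → i ∈ S := fun i hi =>
        hi.induction_on_add (p := fun i => i ∈ S) hsupp
          (fun i j k hk hi hj => hadd i j k hi (hsupp j hj) hk)
      refine fun i => ⟨h1 i, fun hi => ?_⟩
      by_contra hc
      exact hnb i (-i) (hneg i) hi (h1 _ ((Base.IsPos.neg_iff_not b i).2 hc))
    · push Not at hsupp
      obtain ⟨j, hj, hjS⟩ := hsupp
      obtain ⟨b', hb'⟩ := exists_reflected_base P b j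
      refine ih _ ?_ b' rfl
      rw [← hb]
      apply Set.ncard_lt_ncard _ (Set.toFinite _)
      have hjj : P.reflectionPerm j j = -j := rfl
      refine ⟨?_, ?_⟩
      · rintro i ⟨hi, hiS⟩
        refine ⟨?_, hiS⟩
        rw [hb'] at hi
        by_cases hij : P.reflectionPerm j i = j
        · exfalso
          have : i = -j := by
            have h := congrArg (P.reflectionPerm j) hij
            rwa [P.reflectionPerm_self] at h
          rcases htot j (-j) (hneg j) with h | h
          · exact hjS h
          · exact hiS (this ▸ h)
        · have := hi.reflectionPerm hj hij
          simpa using this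
      · intro hsub
        have := (hsub ⟨b.isPos_of_mem_support hj, hjS⟩).1
        rw [hb', hjj, Base.IsPos.neg_iff_not] at this
        exact this (b.isPos_of_mem_support hj)

theorem mem_support_iff_indecomposable (b : P.Base) (i : ι) :
    i ∈ b.support ↔ b.IsPos i ∧
      ¬ ∃ j, b.IsPos j ∧ ∃ k, b.IsPos k ∧ P.root i = P.root j + P.root k := by
  constructor
  · intro hi
    refine ⟨b.isPos_of_mem_support hi, ?_⟩
    rintro ⟨j, hj, k, hk, h⟩
    have := b.height_add h
    rw [Base.height_one_of_mem_support hi] at this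
    rw [Base.isPos_iff] at hj hk
    omega
  · rintro ⟨hi, hd⟩
    obtain ⟨j, hj, hj'⟩ := hi.exists_mem_support_pos_pairingIn
    rw [P.zero_lt_pairingIn_iff'] at hj'
    rcases eq_or_ne i j with rfl | hij
    · exact hj
    obtain ⟨k, hk⟩ := P.root_sub_root_mem_of_pairingIn_pos hj' hij
    exact (hd ⟨k, hi.sub hj hk, j, b.isPos_of_mem_support hj, by rw [hk]; module⟩).elim

end SatakeAux

namespace SatakeAux
open RootPairing Set

theorem span_gen {ι X : Type*} [AddCommGroup X] (S : Finset ι) (V : Set ι) (t : ι) (ht : t ∈ S)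
    (v : ι → X) (c : ι → ℤ) (h1 : c t = 1) (h2 : ∀ l ∈ S, l ∉ V → l ≠ t → c l = 0) :
    ∑ j ∈ S, c j • v j - v t ∈ Submodule.span ℤ (v '' {j | j ∈ S ∧ j ∈ V}) := by
  classical
  rw [← Finset.add_sum_erase _ _ ht, h1, one_smul, add_sub_cancel_left]
  refine Submodule.sum_mem _ fun j hj => ?_
  rw [Finset.mem_erase] at hj
  by_cases hjV : j ∈ V
  · exact Submodule.smul_mem _ _ (Submodule.subset_span ⟨j, ⟨hj.2, hjV⟩, rfl⟩)
  · rw [h2 j hj.2 hjV hj.1, zero_smul]; exact zero_mem _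

section satake
variable {ι R M N : Type*} [Finite ι] [Field R] [CharZero R] [AddCommGroup M] [Module R M]
  [AddCommGroup N] [Module R N] (P : RootPairing ι R M N) [P.IsRootSystem]

/-- The integer matrix of an involution in terms of a base. -/
theorem matrix_sq (b : P.Base) (σ : M →ₗ[R] M) (s : ι → ι)
    (hσ : ∀ i, P.root (s i) = σ (P.root i)) (hs : ∀ i, s (s i) = i) (V : Set ι)
    (hV : ∀ i ∈ V, σ (P.root i) = - P.root i) (n : ι → ι → ℤ)
    (hn : ∀ i, P.root (s i) = ∑ j ∈ b.support, n i j • P.root j) [DecidablePred (· ∈ V)]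
    [DecidableEq ι]
    (i l : ι) (hi : i ∈ b.support) (hl : l ∈ b.support) (hlV : l ∉ V) :
    ∑ j ∈ b.support with j ∉ V, n i j * n j l = if i = l then 1 else 0 := by
  let c : M →ₗ[R] R := b.toWeightBasis.coord ⟨l, hl⟩
  have hc : ∀ j ∈ b.support, c (P.root j) = if j = l then 1 else 0 := by
    intro j hj
    have := b.toWeightBasis_repr_root ⟨j, hj⟩
    simp only at this
    simp only [c, Module.Basis.coord_apply, this, Finsupp.single_apply, Subtype.mk.injEq]
  have hcs : ∀ j, c (σ (P.root j)) = n j l := by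
    intro j
    rw [← hσ, hn, map_sum]
    rw [Finset.sum_eq_single l]
    · simp [hc l hl]
    · intro k hk hkl
      simp [hc k hk, hkl]
    · exact fun h => (h hl).elim
  have h1 : c (P.root i) = ∑ j ∈ b.support with j ∉ V, (n i j : R) * n j l := by
    conv_lhs => rw [← hs i, hσ, hn, map_sum, map_sum]
    rw [Finset.sum_filter]
    refine Finset.sum_congr rfl fun j hj => ?_
    rw [map_zsmul, map_zsmul]
    split_ifs with hjV
    · have : j ≠ l := fun h => hlV (h ▸ hjV)
      simp [hV j hjV, hc j hj, this]
    · rw [hcs, zsmul_eq_mul]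
  rw [hc i hi] at h1
  have : (((if i = l then 1 else 0 : ℤ)) : R)
      = ((∑ j ∈ b.support with j ∉ V, n i j * n j l : ℤ) : R) := by
    push_cast
    rw [← h1]
  exact_mod_cast this.symm

variable [P.IsCrystallographic] [P.IsReduced]

theorem exists_ratio : ∃ q : ι → ℚ, (∀ i, 0 < q i) ∧
    ∃ φ : M ≃ₗ[R] N, ∀ i, P.coroot i = (q i : R) • φ (P.root i) := by
  have : Fintype ι := Fintype.ofFinite ι
  let _i : Module ℚ M := Module.compHom M (algebraMap ℚ R)
  let _i : Module ℚ N := Module.compHom N (algebraMap ℚ R)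
  have aux (i : ι) : ∃ q : ℚ, 0 < q ∧ q = 2 / P.RootForm (P.root i) (P.root i) := by
    refine ⟨2 / P.RootFormIn ℚ (P.rootSpanMem ℚ i) (P.rootSpanMem ℚ i), ?_, ?_⟩
    · simp only [Nat.ofNat_pos, div_pos_iff_of_pos_left, ← posRootForm_eq]
      exact (P.posRootForm ℚ).zero_lt_posForm_apply_root i (P.rootSpanMem ℚ i).property
    · simp [← P.algebraMap_rootFormIn ℚ (P.rootSpanMem ℚ i) (P.rootSpanMem ℚ i)]
  choose q hq hq' using aux
  refine ⟨q, hq, P.PolarizationEquiv, fun i => ?_⟩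
  rw [P.coroot_eq_polarizationEquiv_apply_root, hq']

theorem satake_involution (b : P.Base) (σM : M →ₗ[R] M) (σN : N →ₗ[R] N) (s : ι → ι)
    (hσM : ∀ i, P.root (s i) = σM (P.root i)) (hσN : ∀ i, P.coroot (s i) = σN (P.coroot i))
    (hs : ∀ i, s (s i) = i) (V : Set ι)
    (hV : ∀ i ∈ V, σM (P.root i) = - P.root i)
    (hVc : ∀ i ∈ V, σN (P.coroot i) = - P.coroot i)
    (hpos : ∀ i, b.IsPos i → i ∉ V → b.IsPos (s i)) :
    ∃ τ : ι → ι, ∀ i ∈ b.support, i ∉ V →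
      τ i ∈ b.support ∧ τ i ∉ V ∧ τ (τ i) = i ∧
      (σM (P.root i) - P.root (τ i) ∈ Submodule.span ℤ (P.root '' {j | j ∈ b.support ∧ j ∈ V})) ∧
      (σN (P.coroot i) - P.coroot (τ i) ∈
        Submodule.span ℤ (P.coroot '' {j | j ∈ b.support ∧ j ∈ V})) := by
  classical
  have hn : ∀ i, ∃ f : ι → ℤ, P.root (s i) = ∑ j ∈ b.support, f j • P.root j ∧
      (b.IsPos (s i) → 0 ≤ f) := by
    intro i
    obtain ⟨f, -, h1, h2⟩ := b.exists_root_eq_sum_int (s i)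
    refine ⟨f, h2, fun hp => ?_⟩
    rcases h1 with h | h
    · exact h.le
    · exfalso
      rw [Base.isPos_iff, Base.height_eq_sum h2] at hp
      have := Finset.sum_nonpos (s := b.support) (f := f) (fun j _ => h.le j)
      omega
  choose n hn hn0 using hn
  have hm : ∀ i, ∃ f : ι → ℤ, P.coroot (s i) = ∑ j ∈ b.support, f j • P.coroot j := by
    intro i
    obtain ⟨f, -, -, h2⟩ := b.flip.exists_root_eq_sum_int (s i)
    exact ⟨f, h2⟩
  choose m hm using hm
  obtain ⟨q, hq, φ, hφ⟩ := exists_ratio P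
  have hnm : ∀ i, ∀ j ∈ b.support, (m i j : ℚ) * q j = n i j * q (s i) := by
    intro i j hj
    have h1 := hm i
    rw [hφ, hn, map_sum, Finset.smul_sum] at h1
    have h2 : ∑ j ∈ b.support, ((n i j * q (s i) - m i j * q j : ℚ) : R) • φ (P.root j) = 0 := by
      rw [← sub_eq_zero, ← Finset.sum_sub_distrib] at h1
      rw [← h1]
      refine Finset.sum_congr rfl fun k _ => ?_
      rw [hφ k, map_zsmul, ← Int.cast_smul_eq_zsmul R, ← Int.cast_smul_eq_zsmul R, smul_smul,
        smul_smul, ← sub_smul]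
      congr 1
      push_cast
      ring
    have h3 : ∑ j ∈ b.support, ((n i j * q (s i) - m i j * q j : ℚ) : R) • (P.root j) = 0 := by
      apply φ.injective
      simpa [map_sum] using h2
    have h4 := linearIndepOn_finset_iff.1 b.linearIndepOn_root _ h3 j hj
    have h5 : (n i j * q (s i) - m i j * q j : ℚ) = 0 := by exact_mod_cast h4
    linarith
  have hM := matrix_sq P b σM s hσM hs V hV n hn
  have hN := matrix_sq P.flip b.flip σN s hσN hs V hVc m hm
  -- the permutation
  have key : ∀ i ∈ b.support, i ∉ V → ∃ j ∈ b.support, j ∉ V ∧ n i j = 1 ∧ n j i = 1 ∧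
      (∀ l ∈ b.support, l ∉ V → l ≠ j → n i l = 0) := by
    have hnn : ∀ i ∈ b.support, i ∉ V → ∀ j, 0 ≤ n i j := fun i hi hiV j =>
      hn0 i (hpos i (b.isPos_of_mem_support hi) hiV) j
    intro i hi hiV
    have h1 := hM i i hi hi hiV
    rw [if_pos rfl] at h1
    obtain ⟨j, hj, hj0⟩ := Finset.exists_ne_zero_of_sum_ne_zero (by rw [h1]; exact one_ne_zero)
    have hj' := Finset.mem_filter.1 hj
    have hle : n i j * n j i ≤ 1 := by
      rw [← h1]
      exact Finset.single_le_sum (f := fun j => n i j * n j i) (fun k hk =>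
        mul_nonneg (hnn i hi hiV k) (hnn k (Finset.mem_filter.1 hk).1 (Finset.mem_filter.1 hk).2 i)) hj
    have h2 : n i j * n j i = 1 := by
      have := mul_nonneg (hnn i hi hiV j) (hnn j hj'.1 hj'.2 i)
      omega
    have h3 : n i j = 1 := by
      rcases Int.mul_eq_one_iff_eq_one_or_neg_one.1 h2 with h | h
      · exact h.1
      · have := hnn i hi hiV j; omega
    have h4 : n j i = 1 := by rw [h3, one_mul] at h2; exact h2
    refine ⟨j, hj'.1, hj'.2, h3, h4, fun l hl hlV hlj => ?_⟩
    have h5 := hM j l hj'.1 hl hlV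
    rw [if_neg (Ne.symm hlj)] at h5
    rw [Finset.sum_eq_zero_iff_of_nonneg (fun k hk =>
      mul_nonneg (hnn j hj'.1 hj'.2 k)
        (hnn k (Finset.mem_filter.1 hk).1 (Finset.mem_filter.1 hk).2 l))] at h5
    have h6 := h5 i (Finset.mem_filter.2 ⟨hi, hiV⟩)
    rw [h4, one_mul] at h6
    exact h6
  have key2 : ∀ i, ∃ j, i ∈ b.support → i ∉ V → j ∈ b.support ∧ j ∉ V ∧ n i j = 1 ∧ n j i = 1 ∧
      (∀ l ∈ b.support, l ∉ V → l ≠ j → n i l = 0) := by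
    intro i
    by_cases h : i ∈ b.support ∧ i ∉ V
    · obtain ⟨j, hj⟩ := key i h.1 h.2
      exact ⟨j, fun _ _ => by tauto⟩
    · exact ⟨i, fun h1 h2 => (h ⟨h1, h2⟩).elim⟩
  choose τ hτ using key2
  refine ⟨τ, fun i hi hiV => ?_⟩
  obtain ⟨t1, t2, t3, t4, t5⟩ := hτ i hi hiV
  obtain ⟨u1, u2, u3, u4, u5⟩ := hτ (τ i) t1 t2
  have htt : τ (τ i) = i := by
    by_contra hne
    have := u5 i hi hiV (Ne.symm hne)
    omega
  refine ⟨t1, t2, htt, ?_, ?_⟩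
  · rw [← hσM, hn]
    exact span_gen b.support V (τ i) t1 P.root (n i) t3 t5
  · rw [← hσN, hm]
    have mz : ∀ l ∈ b.support, l ∉ V → l ≠ τ i → m i l = 0 := by
      intro l hl hlV hne
      have h := hnm i l hl
      rw [t5 l hl hlV hne] at h
      simpa [(hq l).ne'] using h
    have mp : ∀ i j, j ∈ b.support → n i j = 1 → 0 < m i j := by
      intro i j hj h1
      have h := hnm i j hj
      rw [h1] at h
      have h2 : (0 : ℚ) < m i j * q j := by rw [h]; simpa using hq (s i)
      have := (mul_pos_iff_of_pos_right (hq j)).1 h2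
      exact_mod_cast this
    refine span_gen b.support V (τ i) t1 P.coroot (m i) ?_ mz
    have h1 := hN i i hi hi hiV
    rw [if_pos rfl, Finset.sum_eq_single (τ i)] at h1
    · have h2 := mp i (τ i) t1 t3
      rcases Int.mul_eq_one_iff_eq_one_or_neg_one.1 h1 with h | h
      · exact h.1
      · omega
    · intro k hk hkne
      rw [Finset.mem_filter] at hk
      rw [mz k hk.1 hk.2 hkne, zero_mul]
    · intro h
      exact (h (Finset.mem_filter.2 ⟨t1, t2⟩)).elim
end satake
end SatakeAux

namespace SatakeAux
open RootPairing Set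

theorem root_sep {ι R M N : Type*} [Field R] [AddCommGroup M] [Module R M]
    [AddCommGroup N] [Module R N] (P : RootPairing ι R M N) [P.IsRootSystem] (y : N)
    (h : ∀ i, P.root' i y = 0) : y = 0 := by
  have h1 : P.toLinearMap.flip y = 0 := by
    apply LinearMap.ext_on_range (v := P.root) IsRootSystem.span_root_eq_top
    intro i
    exact h i
  have := P.toLinearMap.toPerfPair.injective
  have h2 : Function.Injective P.toLinearMap.flip := (P.flip.toLinearMap.toPerfPair).injective
  exact h2 (by rw [h1, map_zero])

theorem linIndep_of_functionals {N : Type*} [AddCommGroup N] [Module ℝ N] (T : Set N)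
    (h : ∀ x ∈ T, ∃ φ : N →ₗ[ℝ] ℂ, φ x = 1 ∧ ∀ y ∈ T, y ≠ x → φ y = 0) :
    LinearIndependent ℝ ((↑) : T → N) := by
  rw [linearIndependent_iff']
  intro s c hc i hi
  obtain ⟨φ, h1, h2⟩ := h i i.2
  have := congrArg φ hc
  rw [map_sum, map_zero, Finset.sum_eq_single i] at this
  · rw [map_smul, h1] at this
    simpa using this
  · intro j _ hj
    rw [map_smul, h2 j j.2 (fun hh => hj (Subtype.ext hh)), smul_zero]
  · exact fun hh => (hh hi).elim

theorem abstract_basis {ι M N : Type*} [AddCommGroup M] [Module ℂ M]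
    [AddCommGroup N] [Module ℂ N] (P : RootPairing ι ℂ M N) [P.IsRootSystem] [P.IsCrystallographic]
    (b : P.Base) (θ : N →ₗ[ℂ] N) (hθ : ∀ x, θ (θ x) = x) (V : Set ι)
    (hV : ∀ i ∈ V, θ (P.coroot i) = P.coroot i) (τ : ι → ι)
    (hτ : ∀ i ∈ b.support, i ∉ V → τ i ∈ b.support ∧ τ i ∉ V ∧ τ (τ i) = i ∧
      ((-θ) (P.coroot i) - P.coroot (τ i) ∈
        Submodule.span ℤ (P.coroot '' {j | j ∈ b.support ∧ j ∈ V})))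
    (T : Set N)
    (hT1 : ∀ i ∈ b.support, i ∈ V → P.coroot i ∈ T)
    (hT2 : ∀ x ∈ T, (∃ i ∈ b.support, i ∈ V ∧ x = P.coroot i) ∨
      (∃ i ∈ b.support, i ∉ V ∧ τ i ≠ i ∧ x = P.coroot i - P.coroot (τ i)))
    (hT3 : ∀ i ∈ b.support, i ∉ V → τ i ≠ i →
      (P.coroot i - P.coroot (τ i) ∈ T ∨ P.coroot (τ i) - P.coroot i ∈ T))
    (hT4 : ∀ i ∈ b.support, i ∉ V → τ i ≠ i →
      ¬ (P.coroot i - P.coroot (τ i) ∈ T ∧ P.coroot (τ i) - P.coroot i ∈ T)) :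
    LinearIndependent ℝ ((↑) : T → N) ∧
    ∀ x, x ∈ Submodule.span ℝ T ↔ (θ x = x ∧ ∀ i, (P.root' i x).im = 0) := by
  classical
  have hc : ∀ (l : ι) (hl : l ∈ b.support), ∀ j ∈ b.support,
      b.toCoweightBasis.coord ⟨l, hl⟩ (P.coroot j) = if j = l then 1 else 0 := by
    intro l hl j hj
    have := b.toCoweightBasis_repr_coroot ⟨j, hj⟩
    simp only at this
    simp only [Module.Basis.coord_apply, this, Finsupp.single_apply, Subtype.mk.injEq]
  have hblack : ∀ x ∈ Submodule.span ℤ (P.coroot '' {j | j ∈ b.support ∧ j ∈ V}), θ x = x := by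
    intro x hx
    induction hx using Submodule.span_induction with
    | mem x h => obtain ⟨j, hj, rfl⟩ := h; exact hV j hj.2
    | zero => simp
    | add x y _ _ h1 h2 => rw [map_add, h1, h2]
    | smul a x _ h => rw [map_zsmul, h]
  have hblackT : ∀ x ∈ Submodule.span ℤ (P.coroot '' {j | j ∈ b.support ∧ j ∈ V}),
      x ∈ Submodule.span ℝ T := by
    intro x hx
    induction hx using Submodule.span_induction with
    | mem x h => obtain ⟨j, hj, rfl⟩ := h; exact Submodule.subset_span (hT1 j hj.1 hj.2)
    | zero => exact zero_mem _
    | add x y _ _ h1 h2 => exact add_mem h1 h2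
    | smul a x _ h => exact zsmul_mem h a
  refine ⟨linIndep_of_functionals T ?_, fun x => ⟨fun hx => ?_, fun hx => ?_⟩⟩
  · intro x hx
    rcases hT2 x hx with ⟨i, hi, hiV, rfl⟩ | ⟨i, hi, hiV, hne, rfl⟩
    · refine ⟨(b.toCoweightBasis.coord ⟨i, hi⟩).restrictScalars ℝ, ?_, fun y hy hyx => ?_⟩
      · simp only [LinearMap.restrictScalars_apply, hc i hi i hi, if_true]
      · simp only [LinearMap.restrictScalars_apply]
        rcases hT2 y hy with ⟨j, hj, hjV, rfl⟩ | ⟨j, hj, hjV, hne, rfl⟩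
        · rw [hc i hi j hj, if_neg]
          rintro rfl; exact hyx rfl
        · obtain ⟨t1, t2, -, -⟩ := hτ j hj hjV
          rw [map_sub, hc i hi j hj, hc i hi _ t1, if_neg, if_neg, sub_zero]
          · rintro rfl; exact t2 hiV
          · rintro rfl; exact hjV hiV
    · obtain ⟨u1, u2, u3, -⟩ := hτ i hi hiV
      refine ⟨(b.toCoweightBasis.coord ⟨i, hi⟩).restrictScalars ℝ, ?_, fun y hy hyx => ?_⟩
      · simp only [LinearMap.restrictScalars_apply, map_sub]
        rw [hc i hi i hi, hc i hi _ u1, if_pos rfl, if_neg hne, sub_zero]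
      · simp only [LinearMap.restrictScalars_apply]
        rcases hT2 y hy with ⟨j, hj, hjV, rfl⟩ | ⟨j, hj, hjV, hne', rfl⟩
        · rw [hc i hi j hj, if_neg]
          rintro rfl; exact hiV hjV
        · obtain ⟨t1, t2, t3, -⟩ := hτ j hj hjV
          rw [map_sub, hc i hi j hj, hc i hi _ t1, if_neg, if_neg, sub_zero]
          · rintro rfl
            rw [t3] at hx
            exact hT4 j hj hjV hne' ⟨hy, hx⟩
          · rintro rfl; exact hyx rfl
  · have hreal : ∀ i j, (P.root' i (P.coroot j)).im = 0 := by
      intro i j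
      rw [P.root'_coroot_eq_pairing, ← P.algebraMap_pairingIn ℤ]
      simp
    induction hx using Submodule.span_induction with
    | mem x h =>
      rcases hT2 x h with ⟨i, hi, hiV, rfl⟩ | ⟨i, hi, hiV, hne, rfl⟩
      · exact ⟨hV i hiV, fun j => hreal j i⟩
      · refine ⟨?_, fun j => by rw [map_sub, Complex.sub_im, hreal, hreal, sub_zero]⟩
        obtain ⟨-, -, -, h4⟩ := hτ i hi hiV
        have h5 := hblack _ h4
        simp only [LinearMap.neg_apply, map_sub, map_neg, hθ] at h5 ⊢
        rw [← sub_eq_zero] at h5 ⊢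
        rw [← h5]
        abel
    | zero => simp
    | add x y _ _ h1 h2 =>
      refine ⟨by rw [map_add, h1.1, h2.1], fun i => by
        rw [map_add, Complex.add_im, h1.2, h2.2, add_zero]⟩
    | smul a x _ h =>
      refine ⟨?_, fun i => ?_⟩
      · rw [← Complex.coe_smul, map_smul, h.1]
      · rw [← Complex.coe_smul, map_smul, smul_eq_mul, Complex.im_ofReal_mul, h.2, mul_zero]
  · obtain ⟨hx1, hx2⟩ := hx
    set B := b.toCoweightBasis with hB
    have hsum : x = ∑ j : b.support, B.repr x j • P.coroot j := by
      conv_lhs => rw [← B.sum_repr x]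
      simp [hB]
    have him : ∀ j, (B.repr x j).im = 0 := by
      have hy : ∑ j : b.support, (((B.repr x j).im : ℝ) : ℂ) • P.coroot j = 0 := by
        apply root_sep P
        intro i
        have h1 := hx2 i
        rw [hsum, map_sum, Complex.im_sum] at h1
        rw [map_sum]
        have h2 : ∀ j : b.support, P.root' i ((((B.repr x j).im : ℝ) : ℂ) • P.coroot j) =
            (((P.root' i (B.repr x j • P.coroot j)).im : ℝ) : ℂ) := by
          intro j
          rw [map_smul, map_smul, P.root'_coroot_eq_pairing, ← P.algebraMap_pairingIn ℤ]
          simp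
        rw [Finset.sum_congr rfl (fun j _ => h2 j), ← Complex.ofReal_sum, h1, Complex.ofReal_zero]
      intro j
      have h3 := Fintype.linearIndependent_iff.1 B.linearIndependent
        (fun j => (((B.repr x j).im : ℝ) : ℂ)) (by rw [← hy]; simp [hB]) j
      exact_mod_cast h3
    have hcr : ∀ j, B.repr x j = ((B.repr x j).re : ℂ) := fun j => by
      apply Complex.ext <;> simp [him]
    have hmem : ∀ j : b.support, P.coroot j + θ (P.coroot j) ∈ Submodule.span ℝ T := by
      intro j
      by_cases hjV : (j : ι) ∈ V
      · rw [hV _ hjV]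
        have := Submodule.subset_span (R := ℝ) (hT1 j j.2 hjV)
        exact add_mem this this
      · obtain ⟨h1, h2, h3, h4⟩ := hτ j j.2 hjV
        have h5 : P.coroot j - P.coroot (τ j) ∈ Submodule.span ℝ T := by
          by_cases hne : τ j = j
          · rw [hne, sub_self]; exact zero_mem _
          · rcases hT3 j j.2 hjV hne with h | h
            · exact Submodule.subset_span h
            · rw [← neg_sub]
              exact neg_mem (Submodule.subset_span h)
        have h6 := sub_mem h5 (hblackT _ h4)
        convert h6 using 1
        simp only [LinearMap.neg_apply]
        abel
    have h2x : x + θ x ∈ Submodule.span ℝ T := by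
      have : x + θ x = ∑ j : b.support, (B.repr x j).re • (P.coroot j + θ (P.coroot j)) := by
        conv_lhs => rw [hsum, map_sum]
        rw [← Finset.sum_add_distrib]
        refine Finset.sum_congr rfl fun j _ => ?_
        rw [map_smul, ← smul_add, hcr, Complex.coe_smul, Complex.ofReal_re]
      rw [this]
      exact Submodule.sum_mem _ fun j _ => Submodule.smul_mem _ _ (hmem j)
    rw [hx1, ← two_smul ℝ] at h2x
    have := Submodule.smul_mem _ (2⁻¹ : ℝ) h2x
    rwa [smul_smul, inv_mul_cancel₀ two_ne_zero, one_smul] at this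
end SatakeAux

namespace SatakeAux
open LieAlgebra LieAlgebra.IsKilling LieModule

section lie
variable {gC : Type*} [LieRing gC] [LieAlgebra ℂ gC] [FiniteDimensional ℂ gC]
    [IsKilling ℂ gC] (hC : LieSubalgebra ℂ gC) [hC.IsCartanSubalgebra]

theorem exists_root_of_eigen (χ : Module.Dual ℂ hC) (hχ : χ ≠ 0) (x : gC) (hx : x ≠ 0)
    (h : ∀ H : hC, ⁅(H : gC), x⁆ = χ H • x) : ∃ i : hC.root, (rootSystem hC).root i = χ := by
  have h1 : x ∈ weightSpace gC (χ : hC → ℂ) := (mem_weightSpace (χ : hC → ℂ) x).2 h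
  have h2 := weightSpace_le_genWeightSpace gC (χ : hC → ℂ) h1
  have h3 : genWeightSpace gC (χ : hC → ℂ) ≠ ⊥ := by
    intro h4
    rw [h4] at h2
    exact hx (by simpa using h2)
  let w : Weight ℂ hC gC := ⟨χ, h3⟩
  have hw : w.IsNonZero := by
    intro h4
    apply hχ
    ext H
    exact congrFun h4 H
  refine ⟨⟨w, by simpa using hw⟩, ?_⟩
  ext H
  rfl

theorem eigen_of_root (i : hC.root) : (rootSystem hC).root i ≠ 0 ∧
    ∃ x : gC, x ≠ 0 ∧ ∀ H : hC, ⁅(H : gC), x⁆ = (rootSystem hC).root i H • x := by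
  refine ⟨(rootSystem hC).ne_zero i, ?_⟩
  obtain ⟨x, hx, hx0⟩ := i.1.exists_ne_zero
  exact ⟨x, hx0, fun H => lie_eq_smul_of_mem_rootSpace hx H⟩

theorem coroot_eq_of_killing (i : hC.root) (t : hC)
    (ht : ∀ H : hC, killingForm ℂ gC t H = (rootSystem hC).root i H) :
    (rootSystem hC).coroot i = (2 / killingForm ℂ gC t t) • t := by
  have hnz : i.1.IsNonZero := hC.isNonZero_coe_root i
  set c : ℂ := 2 * (i.1 ((cartanEquivDual hC).symm i.1))⁻¹ with hc
  have h1 : (rootSystem hC).coroot i = c • t := by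
    rw [← sub_eq_zero]
    refine (traceForm_cartan_nondegenerate ℂ gC hC).1 _ fun H => ?_
    rw [map_sub, map_smul, LinearMap.sub_apply, rootSystem_coroot_apply, traceForm_coroot,
      LinearMap.smul_apply, sub_eq_zero]
    have : traceForm ℂ hC gC t H = killingForm ℂ gC t H := rfl
    rw [this, ht, hc, smul_eq_mul, nsmul_eq_mul, smul_eq_mul, mul_assoc]
    rfl
  have h2 : i.1 (coroot i.1) = 2 := root_apply_coroot hnz
  have h3 : (rootSystem hC).root i ((rootSystem hC).coroot i) = 2 := h2
  rw [h1, map_smul, ← ht] at h3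
  have h4 : killingForm ℂ gC t t ≠ 0 := by
    intro h; rw [h, smul_zero] at h3; norm_num at h3
  rw [h1]
  congr 1
  rw [eq_div_iff h4]
  exact h3

theorem exists_killing_dual (i : hC.root) :
    ∃ t : hC, ∀ H : hC, killingForm ℂ gC t H = (rootSystem hC).root i H := by
  refine ⟨(cartanEquivDual hC).symm i.1, fun H => ?_⟩
  have : killingForm ℂ gC ((cartanEquivDual hC).symm i.1) H =
    cartanEquivDual hC ((cartanEquivDual hC).symm i.1) H := rfl
  rw [this, LinearEquiv.apply_symm_apply]
  rfl

theorem exists_theta_perm (θ : gC ≃ₗ⁅ℂ⁆ gC) (hθ : ∀ x, θ (θ x) = x) (θh : hC →ₗ[ℂ] hC)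
    (hθh : ∀ x : hC, (θh x : gC) = θ x) : ∃ s : hC.root → hC.root,
    (∀ i, (rootSystem hC).root (s i) = -((rootSystem hC).root i ∘ₗ θh)) ∧
    (∀ i, (rootSystem hC).coroot (s i) = - θh ((rootSystem hC).coroot i)) ∧
    ∀ i, s (s i) = i := by
  have hθhh : ∀ x, θh (θh x) = x := fun x => Subtype.ext (by rw [hθh, hθh, hθ])
  have key : ∀ i : hC.root, ∃ j : hC.root,
      (rootSystem hC).root j = -((rootSystem hC).root i ∘ₗ θh) := by
    intro i
    obtain ⟨j, hj⟩ : ∃ j, (rootSystem hC).root j = - (rootSystem hC).root i :=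
      ⟨⟨-i.1, by simpa using hC.isNonZero_coe_root i⟩, rfl⟩
    obtain ⟨h0, x, hx0, hx⟩ := eigen_of_root hC j
    refine exists_root_of_eigen hC _ ?_ (θ x) ?_ ?_
    · intro h
      apply (rootSystem hC).ne_zero i
      ext H
      have := LinearMap.congr_fun h (θh H)
      simpa [hθhh] using this
    · intro h
      exact hx0 (by rw [← hθ x, h, map_zero])
    · intro H
      have h1 := congrArg θ (hx (θh H))
      rw [LieEquiv.map_lie, hθh, hθ, map_smul, hj] at h1
      rw [h1]
      rfl
  choose s hs using key
  refine ⟨s, hs, fun i => ?_, fun i => ?_⟩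
  · obtain ⟨t, ht⟩ := exists_killing_dual hC i
    have hB : ∀ x y, killingForm ℂ gC (θ x) (θ y) = killingForm ℂ gC x y := fun x y =>
      killingForm_of_equiv_apply θ x y
    have h1 := coroot_eq_of_killing hC (s i) (-θh t) (by
      intro H
      rw [hs]
      simp only [NegMemClass.coe_neg, hθh, map_neg, LinearMap.neg_apply, LinearMap.comp_apply]
      rw [← ht, ← hθ (H : gC), hB, hθh])
    rw [h1, coroot_eq_of_killing hC i t ht]
    simp only [NegMemClass.coe_neg, hθh, map_neg, LinearMap.neg_apply, neg_neg, hB, map_smul,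
      smul_neg]
  · apply (rootSystem hC).root.injective
    rw [hs, hs]
    ext H
    simp [hθhh]
end lie
end SatakeAux

namespace SatakeAux
open LieAlgebra SmallestOrbitPaper

section cartan
variable {gC : Type*} [LieRing gC] [LieAlgebra ℂ gC]

theorem I_smul_I_smul (x : gC) : Complex.I • Complex.I • x = - x := by
  rw [smul_smul, Complex.I_mul_I, neg_one_smul]

/-- The real subspace `m + I n`. -/
def addI (m n : Submodule ℝ gC) : Submodule ℝ gC where
  carrier := {z | ∃ x ∈ m, ∃ y ∈ n, z = x + Complex.I • y}
  add_mem' := by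
    rintro _ _ ⟨x, hx, y, hy, rfl⟩ ⟨x', hx', y', hy', rfl⟩
    exact ⟨x + x', add_mem hx hx', y + y', add_mem hy hy', by rw [smul_add]; abel⟩
  zero_mem' := ⟨0, zero_mem _, 0, zero_mem _, by simp⟩
  smul_mem' := by
    rintro c _ ⟨x, hx, y, hy, rfl⟩
    refine ⟨c • x, Submodule.smul_mem _ _ hx, c • y, Submodule.smul_mem _ _ hy, ?_⟩
    rw [smul_add, smul_comm]

/-- The complexification `m + I m` as a complex subspace. -/
def cplx (m : Submodule ℝ gC) : Submodule ℂ gC where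
  carrier := {z | ∃ x ∈ m, ∃ y ∈ m, z = x + Complex.I • y}
  add_mem' := by
    rintro _ _ ⟨x, hx, y, hy, rfl⟩ ⟨x', hx', y', hy', rfl⟩
    exact ⟨x + x', add_mem hx hx', y + y', add_mem hy hy', by rw [smul_add]; abel⟩
  zero_mem' := ⟨0, zero_mem _, 0, zero_mem _, by simp⟩
  smul_mem' := by
    rintro c _ ⟨x, hx, y, hy, rfl⟩
    refine ⟨c.re • x - c.im • y, sub_mem (Submodule.smul_mem _ _ hx) (Submodule.smul_mem _ _ hy),
      c.re • y + c.im • x, add_mem (Submodule.smul_mem _ _ hy) (Submodule.smul_mem _ _ hx), ?_⟩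
    have hc : c = (c.re : ℂ) + (c.im : ℂ) * Complex.I := (Complex.re_add_im c).symm
    conv_lhs => rw [hc]
    simp only [← Complex.coe_smul]
    simp only [add_smul, mul_smul, smul_add, I_smul_I_smul]
    module

theorem mem_cplx {m : Submodule ℝ gC} {z : gC} :
    z ∈ cplx m ↔ ∃ x ∈ m, ∃ y ∈ m, z = x + Complex.I • y := Iff.rfl

theorem le_cplx {m : Submodule ℝ gC} {z : gC} (h : z ∈ m) : z ∈ cplx m :=
  ⟨z, h, 0, zero_mem _, by simp⟩

theorem lie_cplx {m n l : Submodule ℝ gC} (h : ∀ x ∈ m, ∀ y ∈ n, ⁅x, y⁆ ∈ l) :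
    ∀ x ∈ cplx m, ∀ y ∈ cplx n, ⁅x, y⁆ ∈ cplx l := by
  rintro _ ⟨x, hx, y, hy, rfl⟩ _ ⟨x', hx', y', hy', rfl⟩
  refine ⟨⁅x, x'⁆ - ⁅y, y'⁆, sub_mem (h _ hx _ hx') (h _ hy _ hy'), ⁅x, y'⁆ + ⁅y, x'⁆,
    add_mem (h _ hx _ hy') (h _ hy _ hx'), ?_⟩
  simp only [add_lie, lie_add, smul_lie, lie_smul, I_smul_I_smul, smul_add]
  abel

theorem realForm_unique {g : Submodule ℝ gC} (hg : IsRealForm g) {x y : gC} (hx : x ∈ g)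
    (hy : y ∈ g) (h : x + Complex.I • y = 0) : x = 0 ∧ y = 0 := by
  have h1 : Complex.I • y = -x := by rw [eq_neg_iff_add_eq_zero, add_comm, h]
  have h2 : y = 0 := hg.indep y hy (by rw [h1]; exact neg_mem hx)
  refine ⟨?_, h2⟩
  rw [h2] at h
  simpa using h

variable {g k p : Submodule ℝ gC}

theorem kp_unique (hkp : IsCartanDecomposition g k p) {x y : gC} (hx : x ∈ k) (hy : y ∈ p)
    (h : x = y) : x = 0 ∧ y = 0 := by
  have : x ∈ k ⊓ p := ⟨hx, h ▸ hy⟩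
  rw [hkp.inf_eq, Submodule.mem_bot] at this
  exact ⟨this, h ▸ this⟩

theorem isCompl_cplx (hg : IsRealForm g) (hkp : IsCartanDecomposition g k p) :
    IsCompl (cplx k) (cplx p) := by
  constructor
  · rw [Submodule.disjoint_def]
    rintro z ⟨x, hx, y, hy, rfl⟩ ⟨x', hx', y', hy', h⟩
    obtain ⟨h1, h2⟩ := realForm_unique hg (sub_mem (hkp.k_le hx) (hkp.p_le hx'))
      (sub_mem (hkp.k_le hy) (hkp.p_le hy')) (by
        rw [smul_sub, sub_add_sub_comm, h, sub_self])
    rw [(kp_unique hkp hx hx' (sub_eq_zero.1 h1)).1, (kp_unique hkp hy hy' (sub_eq_zero.1 h2)).1]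
    simp
  · rw [codisjoint_iff, eq_top_iff]
    intro z _
    obtain ⟨x, hx, y, hy, rfl⟩ := hg.spans z
    rw [← hkp.sup_eq, Submodule.mem_sup] at hx hy
    obtain ⟨x1, hx1, x2, hx2, rfl⟩ := hx
    obtain ⟨y1, hy1, y2, hy2, rfl⟩ := hy
    rw [Submodule.mem_sup]
    exact ⟨x1 + Complex.I • y1, ⟨x1, hx1, y1, hy1, rfl⟩, x2 + Complex.I • y2,
      ⟨x2, hx2, y2, hy2, rfl⟩, by rw [smul_add]; abel⟩

theorem exists_theta (hg : IsRealForm g) (hkp : IsCartanDecomposition g k p) :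
    ∃ θ : gC ≃ₗ⁅ℂ⁆ gC, (∀ x, θ (θ x) = x) ∧ (∀ x ∈ k, θ x = x) ∧ (∀ x ∈ p, θ x = -x) := by
  have hc := isCompl_cplx hg hkp
  let f : gC →ₗ[ℂ] gC := LinearMap.ofIsCompl hc (cplx k).subtype (-(cplx p).subtype)
  have fk : ∀ x ∈ cplx k, f x = x := fun x hx => by
    have := LinearMap.ofIsCompl_apply_left hc (φ := (cplx k).subtype) (ψ := -(cplx p).subtype) ⟨x, hx⟩
    exact this
  have fp : ∀ x ∈ cplx p, f x = -x := fun x hx => by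
    have := LinearMap.ofIsCompl_apply_right hc (φ := (cplx k).subtype) (ψ := -(cplx p).subtype) ⟨x, hx⟩
    exact this
  have dec : ∀ z : gC, ∃ x ∈ cplx k, ∃ y ∈ cplx p, x + y = z := fun z =>
    Submodule.mem_sup.1 (by rw [hc.sup_eq_top]; trivial)
  have ff : ∀ z, f (f z) = z := by
    intro z
    obtain ⟨x, hx, y, hy, rfl⟩ := dec z
    simp only [map_add, map_neg, fk x hx, fp y hy, neg_neg]
  have hl : ∀ z w, f ⁅z, w⁆ = ⁅f z, f w⁆ := by
    intro z w
    obtain ⟨x, hx, y, hy, rfl⟩ := dec z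
    obtain ⟨x', hx', y', hy', rfl⟩ := dec w
    have hpk : ∀ x ∈ p, ∀ y ∈ k, ⁅x, y⁆ ∈ p := fun x hx y hy => by
      rw [← lie_skew]; exact neg_mem (hkp.lie_kp y hy x hx)
    have e1 := fk _ (lie_cplx hkp.lie_kk x hx x' hx')
    have e2 := fp _ (lie_cplx hkp.lie_kp x hx y' hy')
    have e3 := fp _ (lie_cplx hpk y hy x' hx')
    have e4 := fk _ (lie_cplx hkp.lie_pp y hy y' hy')
    simp only [add_lie, lie_add, map_add, e1, e2, e3, e4, fk x hx, fk x' hx', fp y hy, fp y' hy',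
      neg_lie, lie_neg]
    abel
  let θ : gC ≃ₗ⁅ℂ⁆ gC :=
    { toFun := f
      map_add' := f.map_add
      map_smul' := f.map_smul
      map_lie' := fun {x y} => hl x y
      invFun := f
      left_inv := ff
      right_inv := ff }
  exact ⟨θ, ff, fun x hx => fk x (le_cplx hx), fun x hx => fp x (le_cplx hx)⟩

theorem killing_kp (hg : IsRealForm g) (hkp : IsCartanDecomposition g k p) {x y : gC}
    (hx : x ∈ k) (hy : y ∈ p) : killingForm ℂ gC x y = 0 := by
  obtain ⟨θ, -, h1, h2⟩ := exists_theta hg hkp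
  have := killingForm_of_equiv_apply θ x y
  rw [h1 x hx, h2 y hy, map_neg] at this
  exact self_eq_neg.1 this.symm

theorem killing_compact (hg : IsRealForm g) (hkp : IsCartanDecomposition g k p) {z : gC}
    (hz : z ∈ addI k p) (h0 : z ≠ 0) : (killingForm ℂ gC z z).re < 0 := by
  obtain ⟨x, hx, y, hy, rfl⟩ := hz
  have h1 := killing_kp hg hkp hx hy
  have h2 : killingForm ℂ gC y x = 0 := by rw [LieModule.traceForm_comm]; exact h1
  have h3 : killingForm ℂ gC (x + Complex.I • y) (x + Complex.I • y) =
      killingForm ℂ gC x x - killingForm ℂ gC y y := by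
    simp only [map_add, map_smul, LinearMap.add_apply, LinearMap.smul_apply, h1, h2, smul_eq_mul,
      mul_zero, add_zero, zero_add, ← mul_assoc, Complex.I_mul_I]
    ring
  rw [h3, Complex.sub_re]
  by_cases hx0 : x = 0
  · have hy0 : y ≠ 0 := by rintro rfl; exact h0 (by simp [hx0])
    have := hkp.killing_pos y hy hy0
    simp only [hx0, map_zero, Complex.zero_re]
    linarith
  · have h4 := hkp.killing_neg x hx hx0
    by_cases hy0 : y = 0
    · simp only [hy0, map_zero, Complex.zero_re]; linarith
    · have := hkp.killing_pos y hy hy0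
      linarith

theorem compact_unique (hg : IsRealForm g) (hkp : IsCartanDecomposition g k p) {z w : gC}
    (hz : z ∈ addI k p) (hw : w ∈ addI k p) (h : z + Complex.I • w = 0) : z = 0 ∧ w = 0 := by
  obtain ⟨x, hx, y, hy, rfl⟩ := hz
  obtain ⟨x', hx', y', hy', rfl⟩ := hw
  obtain ⟨h1, h2⟩ := realForm_unique hg (sub_mem (hkp.k_le hx) (hkp.p_le hy'))
    (add_mem (hkp.p_le hy) (hkp.k_le hx')) (by
      rw [← h]; simp only [smul_add, I_smul_I_smul]; abel)
  obtain ⟨e1, e2⟩ := kp_unique hkp hx hy' (sub_eq_zero.1 h1)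
  obtain ⟨e3, e4⟩ := kp_unique hkp hx' (neg_mem hy) (eq_neg_of_add_eq_zero_right h2)
  rw [neg_eq_zero] at e4
  simp [e1, e2, e3, e4]

theorem eigen_real (hg : IsRealForm g) (hkp : IsCartanDecomposition g k p) {x v : gC} {c : ℂ}
    (hx : Complex.I • x ∈ k) (hv : v ≠ 0) (h : ⁅x, v⁆ = c • v) : c.im = 0 := by
  obtain ⟨y, hy⟩ : ∃ y, y = Complex.I • x := ⟨_, rfl⟩
  rw [← hy] at hx
  have hyv : ⁅y, v⁆ = Complex.I • c • v := by rw [hy, smul_lie, h]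
  -- decompose
  obtain ⟨A, hA, B, hB, rfl⟩ : ∃ A ∈ addI k p, ∃ B ∈ addI k p, v = A + Complex.I • B := by
    obtain ⟨x, hx, y, hy, rfl⟩ := hg.spans v
    rw [← hkp.sup_eq, Submodule.mem_sup] at hx hy
    obtain ⟨x1, hx1, x2, hx2, rfl⟩ := hx
    obtain ⟨y1, hy1, y2, hy2, rfl⟩ := hy
    refine ⟨x1 + Complex.I • y2, ⟨x1, hx1, y2, hy2, rfl⟩, y1 + Complex.I • (-x2),
      ⟨y1, hy1, -x2, neg_mem hx2, rfl⟩, ?_⟩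
    simp only [smul_add, smul_neg, I_smul_I_smul]
    abel
  have hu : ∀ z ∈ addI k p, ⁅y, z⁆ ∈ addI k p := by
    rintro _ ⟨x', hx', y', hy', rfl⟩
    exact ⟨⁅y, x'⁆, hkp.lie_kk _ hx _ hx', ⁅y, y'⁆, hkp.lie_kp _ hx _ hy', by
      rw [lie_add, lie_smul]⟩
  obtain ⟨h1, h2⟩ := compact_unique hg hkp
    (z := ⁅y, A⁆ + c.im • A + c.re • B) (w := ⁅y, B⁆ - c.re • A + c.im • B)
    (add_mem (add_mem (hu A hA) (Submodule.smul_mem _ _ hA)) (Submodule.smul_mem _ _ hB))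
    (add_mem (sub_mem (hu B hB) (Submodule.smul_mem _ _ hA)) (Submodule.smul_mem _ _ hB)) (by
      rw [lie_add, lie_smul] at hyv
      have hc : c = (c.re : ℂ) + (c.im : ℂ) * Complex.I := (Complex.re_add_im c).symm
      have : ⁅y, A⁆ = Complex.I • c • (A + Complex.I • B) - Complex.I • ⁅y, B⁆ := by
        rw [← hyv]; abel
      rw [this]
      simp only [← Complex.coe_smul]
      generalize hr : (c.re : ℂ) = r at *
      generalize hs : (c.im : ℂ) = s at *
      rw [hc]
      simp only [add_smul, mul_smul, smul_add, smul_sub, smul_comm s Complex.I,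
        smul_comm r Complex.I, I_smul_I_smul, smul_neg]
      module)
  have hinv : ∀ z, killingForm ℂ gC ⁅y, z⁆ z = 0 := by
    intro z
    rw [LieModule.traceForm_apply_lie_apply, lie_self, map_zero]
  have e1 := hinv A
  have e2 := hinv B
  have e3 : ⁅y, A⁆ = - ((c.im : ℂ) • A + (c.re : ℂ) • B) := by
    rw [eq_neg_iff_add_eq_zero, ← h1]; simp only [Complex.coe_smul]; abel
  have e4 : ⁅y, B⁆ = (c.re : ℂ) • A - (c.im : ℂ) • B := by
    rw [← sub_eq_zero, ← h2]; simp only [Complex.coe_smul]; abel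
  rw [e3] at e1
  rw [e4] at e2
  simp only [map_add, map_sub, map_neg, map_smul, LinearMap.add_apply, LinearMap.sub_apply,
    LinearMap.neg_apply, LinearMap.smul_apply, smul_eq_mul] at e1 e2
  have e5 : killingForm ℂ gC B A = killingForm ℂ gC A B := LieModule.traceForm_comm ℂ gC gC B A
  have e6 : (c.im : ℂ) * (killingForm ℂ gC A A + killingForm ℂ gC B B) = 0 := by
    rw [e5] at e1
    linear_combination -e1 - e2
  have e7 := congrArg Complex.re e6
  rw [Complex.re_ofReal_mul, Complex.add_re, Complex.zero_re] at e7
  rcases mul_eq_zero.1 e7 with h | h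
  · exact h
  · exfalso
    by_cases hA0 : A = 0
    · have hB0 : B ≠ 0 := by rintro rfl; exact hv (by simp [hA0])
      have := killing_compact hg hkp hB hB0
      simp only [hA0, map_zero, Complex.zero_re] at h
      linarith
    · have h3 := killing_compact hg hkp hA hA0
      by_cases hB0 : B = 0
      · simp only [hB0, map_zero, Complex.zero_re] at h; linarith
      · have := killing_compact hg hkp hB hB0
        linarith
end cartan
end SatakeAux

namespace SmallestOrbitPaper

variable {gC : Type*} [LieRing gC] [LieAlgebra ℂ gC]

/-- **Lemma 5.4 (Okuda).** Let `g` be a real form of a complex semisimple Lie algebra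
`gC`, with Satake diagram on the simple system `Π` of `Δ⁺(gC,hC)`.  The set
`{H_α : α black} ∪ {H_α − H_β : α, β joined by an arrow}` (with one element chosen for
each arrow, `Hco α` denoting the coroot of `α`) is a basis of the real vector space
`√-1 t = {x ∈ hC | √-1 x ∈ k}`. -/
theorem coroots_basis_of_it
    {gC : Type*} [LieRing gC] [LieAlgebra ℂ gC] [FiniteDimensional ℂ gC]
    [LieAlgebra.IsSemisimple ℂ gC]
    (g k p a : Submodule ℝ gC) (hg : IsRealForm g)
    (hkp : IsCartanDecomposition g k p)
    (ha : IsMaximalAbelianIn a p)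
    (P : Set (Module.Dual ℝ a)) (hP : IsPositiveSystem g a P)
    (hC : LieSubalgebra ℂ gC) [hC.IsCartanSubalgebra] (hah : ∀ x ∈ a, x ∈ hC)
    (hspan : Submodule.span ℂ
        ({x : gC | x ∈ hC ∧ Complex.I • x ∈ k} ∪ (a : Set gC)) = hC.toSubmodule)
    (PC : Set (Module.Dual ℂ hC)) (hPC : IsPositiveSystemC hC PC)
    (hcompat : CompatiblePositiveSystems hC a hah PC P)
    (Hco : Module.Dual ℂ hC → gC)
    (hHco : ∀ α ∈ rootsC hC, ∃ t : gC, ∃ ht : t ∈ hC,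
        (∀ H : hC, killingForm ℂ gC t H = α H) ∧
        Hco α = (2 / killingForm ℂ gC t t) • t)
    (T : Set gC)
    (hT1 : ∀ α ∈ simpleSystemC hC PC, VanishesOnA hC a hah α → Hco α ∈ T)
    (hT2 : ∀ x ∈ T,
        (∃ α ∈ simpleSystemC hC PC, VanishesOnA hC a hah α ∧ x = Hco α) ∨
        (∃ α β : Module.Dual ℂ hC, JoinedByArrow hC a hah PC α β ∧ x = Hco α - Hco β))
    (hT3 : ∀ α β : Module.Dual ℂ hC, JoinedByArrow hC a hah PC α β →
        (Hco α - Hco β ∈ T ∨ Hco β - Hco α ∈ T))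
    (hT4 : ∀ α β : Module.Dual ℂ hC, JoinedByArrow hC a hah PC α β →
        ¬(Hco α - Hco β ∈ T ∧ Hco β - Hco α ∈ T)) :
    LinearIndependent ℝ ((↑) : T → gC) ∧
    Submodule.span ℝ T = Submodule.span ℝ {x : gC | x ∈ hC ∧ Complex.I • x ∈ k} := by
  classical
  let RS := LieAlgebra.IsKilling.rootSystem hC
  have hroots : ∀ χ, χ ∈ rootsC hC ↔ ∃ i, RS.root i = χ := by
    intro χ
    constructor
    · rintro ⟨h0, x, hx, hx0⟩
      exact SatakeAux.exists_root_of_eigen hC χ h0 x hx0 hx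
    · rintro ⟨i, rfl⟩
      obtain ⟨h0, x, hx0, hx⟩ := SatakeAux.eigen_of_root hC i
      exact ⟨h0, x, hx, hx0⟩
  have hrt : ∀ i, RS.root i ∈ rootsC hC := fun i => (hroots _).2 ⟨i, rfl⟩
  have hHc : ∀ i, Hco (RS.root i) = (RS.coroot i : gC) := by
    intro i
    obtain ⟨t, ht, h1, h2⟩ := hHco _ (hrt i)
    have h3 : RS.coroot i = _ := SatakeAux.coroot_eq_of_killing hC i ⟨t, ht⟩ h1
    rw [h2, h3]
    rfl
  -- the Cartan involution
  obtain ⟨θ, hθ, hθk, hθp⟩ := SatakeAux.exists_theta hg hkp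
  have hθit : ∀ x : gC, Complex.I • x ∈ k → θ x = x := by
    intro x hx
    have h1 := hθk _ hx
    rw [map_smul] at h1
    exact smul_right_injective gC Complex.I_ne_zero h1
  have hθa : ∀ x ∈ a, θ x = -x := fun x hx => hθp x (ha.le hx)
  have hθmem : ∀ x ∈ hC, θ x ∈ hC := by
    intro x hx
    have hx' : x ∈ hC.toSubmodule := hx
    change θ x ∈ hC.toSubmodule
    rw [← hspan] at hx'
    clear hx
    induction hx' using Submodule.span_induction with
    | mem x h =>
      rcases h with h | h
      · rw [hθit x h.2]; exact h.1
      · rw [hθa x h]; exact neg_mem (hah x h)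
    | zero => rw [map_zero]; exact zero_mem _
    | add x y _ _ h1 h2 =>
      rw [map_add]; exact add_mem h1 h2
    | smul c x _ h =>
      rw [map_smul]; exact Submodule.smul_mem _ _ h
  let θh : hC →ₗ[ℂ] hC :=
    { toFun := fun x => ⟨θ x, hθmem x x.2⟩
      map_add' := fun x y => Subtype.ext (by simp)
      map_smul' := fun c x => Subtype.ext (by simp) }
  have hθh : ∀ x : hC, (θh x : gC) = θ x := fun _ => rfl
  have hθhh : ∀ x : hC, θh (θh x) = x := fun x => Subtype.ext (by rw [hθh, hθh, hθ])
  have hθha : ∀ x (hx : x ∈ a), θh ⟨x, hah x hx⟩ = -⟨x, hah x hx⟩ := fun x hx =>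
    Subtype.ext (hθa x hx)
  have hind : ∀ W : Submodule ℂ hC, (∀ x (hx : x ∈ hC), Complex.I • x ∈ k → ⟨x, hx⟩ ∈ W) →
      (∀ x (hx : x ∈ a), ⟨x, hah x hx⟩ ∈ W) → ∀ H, H ∈ W := by
    intro W h1 h2 H
    have h3 : hC.toSubmodule ≤ W.map hC.toSubmodule.subtype := by
      conv_lhs => rw [← hspan]
      rw [Submodule.span_le]
      rintro x (hx | hx)
      · exact ⟨⟨x, hx.1⟩, h1 x hx.1 hx.2, rfl⟩
      · exact ⟨⟨x, hah x hx⟩, h2 x hx, rfl⟩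
    obtain ⟨w, hw, e⟩ := h3 H.2
    have : w = H := Subtype.ext e
    rw [← this]; exact hw
  have hvan : ∀ χ : Module.Dual ℂ hC, VanishesOnA hC a hah χ → χ ∘ₗ θh = χ := by
    intro χ hχ
    ext H
    have h1 := hind (LinearMap.ker (χ ∘ₗ θh - χ)) (by
      intro x hx hxk
      have : θh ⟨x, hx⟩ = ⟨x, hx⟩ := Subtype.ext (hθit x hxk)
      simp [this]) (by
      intro x hx
      simp [hθha x hx, hχ x hx]) H
    simpa [sub_eq_zero] using h1
  obtain ⟨s, hsM, hsN, hss⟩ := SatakeAux.exists_theta_perm hC θ hθ θh hθh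
  change ∀ i, RS.root (s i) = -(RS.root i ∘ₗ θh) at hsM
  change ∀ i, RS.coroot (s i) = -θh (RS.coroot i) at hsN
  let V : Set hC.root := {i | VanishesOnA hC a hah (RS.root i)}
  let σM : Module.Dual ℂ hC →ₗ[ℂ] Module.Dual ℂ hC := -(LinearMap.dualMap θh)
  have hσM : ∀ χ, σM χ = -(χ ∘ₗ θh) := fun χ => rfl
  have hV : ∀ i ∈ V, σM (RS.root i) = -RS.root i := fun i hi => by
    rw [hσM, hvan _ hi]
  have hVc : ∀ i ∈ V, (-θh) (RS.coroot i) = -RS.coroot i := by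
    intro i hi
    rw [LinearMap.neg_apply, ← hsN]
    obtain ⟨t, ht⟩ := SatakeAux.exists_killing_dual hC i
    have h1 : RS.coroot i = _ := SatakeAux.coroot_eq_of_killing hC i t ht
    have h2 : RS.coroot (s i) = _ := SatakeAux.coroot_eq_of_killing hC (s i) (-t) (by
      intro H
      have h3 : RS.root (s i) = -RS.root i := by rw [hsM, hvan _ hi]
      change _ = RS.root (s i) H
      rw [h3, LinearMap.neg_apply, NegMemClass.coe_neg, map_neg, LinearMap.neg_apply, ht])
    rw [h1, h2]
    simp
  have hresS : ∀ i x (hx : x ∈ a), RS.root (s i) ⟨x, hah x hx⟩ = RS.root i ⟨x, hah x hx⟩ := by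
    intro i x hx
    rw [hsM, LinearMap.neg_apply, LinearMap.comp_apply, hθha x hx, map_neg, neg_neg]
  -- the base
  obtain ⟨b, hb⟩ := SatakeAux.exists_base_of_positive RS {i | RS.root i ∈ PC}
    (by
      intro i j hij
      rcases hPC.total _ (hrt i) with h | h
      · exact Or.inl h
      · exact Or.inr (by rw [Set.mem_ofPred_eq, hij]; exact h))
    (by
      intro i j hij hi hj
      rw [Set.mem_ofPred_eq, hij] at hj
      exact hPC.not_both _ hi hj)
    (by
      intro i j l hi hj hl
      have h1 := hrt l
      rw [hl] at h1
      rw [Set.mem_ofPred_eq, hl]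
      exact hPC.add_mem _ hi _ hj h1)
  simp only [Set.mem_ofPred_eq] at hb
  have hsupp : ∀ i, i ∈ b.support ↔ RS.root i ∈ simpleSystemC hC PC := by
    intro i
    rw [SatakeAux.mem_support_iff_indecomposable, hb]
    refine and_congr Iff.rfl (not_congr ⟨?_, ?_⟩)
    · rintro ⟨j, hj, l, hl, e⟩
      exact ⟨_, (hb j).1 hj, _, (hb l).1 hl, e⟩
    · rintro ⟨β, hβ, γ, hγ, e⟩
      obtain ⟨j, rfl⟩ := (hroots β).1 (hPC.subset hβ)
      obtain ⟨l, rfl⟩ := (hroots γ).1 (hPC.subset hγ)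
      exact ⟨j, (hb j).2 hβ, l, (hb l).2 hγ, e⟩
  have hidx : ∀ α ∈ simpleSystemC hC PC, ∃ i ∈ b.support, RS.root i = α := by
    intro α hα
    obtain ⟨i, rfl⟩ := (hroots α).1 (hPC.subset hα.1)
    exact ⟨i, (hsupp i).2 hα, rfl⟩
  have hpos : ∀ i, b.IsPos i → i ∉ V → b.IsPos (s i) := by
    intro i hi hiV
    rw [hb] at hi ⊢
    rcases hPC.total _ (hrt (s i)) with h | h
    · exact h
    · exfalso
      obtain ⟨ξ, hξ, hξ'⟩ := hcompat _ hi hiV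
      obtain ⟨η, hη, hη'⟩ := hcompat _ h (by
        intro hv
        apply hiV
        intro x hx
        have := hv x hx
        rwa [LinearMap.neg_apply, hresS i x hx, neg_eq_zero] at this)
      apply hP.not_both ξ hξ
      have : -ξ = η := by
        ext ⟨x, hx⟩
        have h1 := hξ' x hx
        have h2 := hη' x hx
        rw [LinearMap.neg_apply, hresS i x hx, h1] at h2
        rw [LinearMap.neg_apply]
        exact_mod_cast h2
      rw [this]; exact hη
  obtain ⟨τ, hτ⟩ := SatakeAux.satake_involution RS b σM (-θh) s hsM hsN hss V hV hVc hpos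
  -- arrows
  have hspanV : ∀ χ ∈ Submodule.span ℤ (RS.root '' {j | j ∈ b.support ∧ j ∈ V}),
      ∀ x (hx : x ∈ a), χ ⟨x, hah x hx⟩ = 0 := by
    intro χ hχ x hx
    induction hχ using Submodule.span_induction with
    | mem χ h => obtain ⟨j, hj, rfl⟩ := h; exact hj.2 x hx
    | zero => rfl
    | add χ ψ _ _ h1 h2 => rw [LinearMap.add_apply, h1, h2, add_zero]
    | smul c χ _ h => rw [LinearMap.smul_apply, h, smul_zero]
  have harrow1 : ∀ i ∈ b.support, i ∉ V → τ i ≠ i →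
      JoinedByArrow hC a hah PC (RS.root i) (RS.root (τ i)) := by
    intro i hi hiV hne
    obtain ⟨t1, t2, t3, t4, t5⟩ := hτ i hi hiV
    refine ⟨(hsupp i).1 hi, (hsupp _).1 t1, fun h => hne (RS.root.injective h.symm), hiV, t2, ?_⟩
    intro x hx
    have h1 := hspanV _ t4 x hx
    have h2 : σM (RS.root i) = RS.root (s i) := (hsM i).symm
    rw [LinearMap.sub_apply, h2, hresS i x hx, sub_eq_zero] at h1
    exact h1
  have harrow2 : ∀ α β, JoinedByArrow hC a hah PC α β →
      ∃ i ∈ b.support, i ∉ V ∧ τ i ≠ i ∧ α = RS.root i ∧ β = RS.root (τ i) := by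
    rintro α β ⟨h1, h2, h3, h4, h5, h6⟩
    obtain ⟨i, hi, rfl⟩ := hidx α h1
    obtain ⟨j, hj, rfl⟩ := hidx β h2
    have hij : i ≠ j := fun h => h3 (by rw [h])
    have hiV : i ∉ V := h4
    have hjV : j ∉ V := h5
    obtain ⟨t1, t2, t3, t4, -⟩ := hτ i hi hiV
    obtain ⟨u1, u2, u3, u4, -⟩ := hτ j hj hjV
    have hc : ∀ l ∈ b.support,
        b.toWeightBasis.coord ⟨j, hj⟩ (RS.root l) = if l = j then 1 else 0 := by
      intro l hl
      have := b.toWeightBasis_repr_root ⟨l, hl⟩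
      simp only at this
      simp only [Module.Basis.coord_apply, this, Finsupp.single_apply, Subtype.mk.injEq]
    have hcV : ∀ χ ∈ Submodule.span ℤ (RS.root '' {j | j ∈ b.support ∧ j ∈ V}),
        b.toWeightBasis.coord ⟨j, hj⟩ χ = 0 := by
      intro χ hχ
      induction hχ using Submodule.span_induction with
      | mem χ h =>
        obtain ⟨l, hl, rfl⟩ := h
        rw [hc l hl.1, if_neg]
        rintro rfl
        exact hjV hl.2
      | zero => exact map_zero _
      | add χ ψ _ _ h1 h2 => rw [map_add, h1, h2, add_zero]
      | smul c χ _ h => rw [map_zsmul, h, smul_zero]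
    have e1 := hcV _ t4
    have e2 := hcV _ u4
    have e3 : σM (RS.root i) - σM (RS.root j) = RS.root j - RS.root i := by
      rw [← map_sub, hσM, hvan, neg_sub]
      intro x hx
      rw [LinearMap.sub_apply, h6 x hx, sub_self]
    have e4 := congrArg (b.toWeightBasis.coord ⟨j, hj⟩) e3
    rw [map_sub, sub_eq_zero, hc _ t1] at e1
    rw [map_sub, sub_eq_zero, hc _ u1] at e2
    rw [map_sub, map_sub, e1, e2, hc j hj, hc i hi, if_pos rfl, if_neg hij] at e4
    have hτi : τ i = j := by
      by_contra hne
      rw [if_neg hne] at e4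
      split_ifs at e4 <;> norm_num at e4
    exact ⟨i, hi, hiV, by rw [hτi]; exact hij.symm, rfl, by rw [hτi]⟩
  -- `it` in terms of `θ` and reality of the roots
  have hit1 : ∀ X : hC, Complex.I • (X : gC) ∈ k → θh X = X ∧ ∀ i, (RS.root i X).im = 0 := by
    intro X hX
    refine ⟨Subtype.ext (hθit X hX), fun i => ?_⟩
    obtain ⟨-, v, hv0, hv⟩ := SatakeAux.eigen_of_root hC i
    exact SatakeAux.eigen_real hg hkp hX hv0 (hv X)
  let itR : Submodule ℝ gC :=
    { carrier := {x | x ∈ hC ∧ Complex.I • x ∈ k}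
      add_mem' := fun {x y} hx hy => ⟨add_mem hx.1 hy.1, by
        rw [smul_add]; exact add_mem hx.2 hy.2⟩
      zero_mem' := ⟨zero_mem _, by rw [smul_zero]; exact zero_mem _⟩
      smul_mem' := fun c x hx => ⟨by
        rw [← Complex.coe_smul]; exact hC.toSubmodule.smul_mem _ hx.1, by
        rw [smul_comm]; exact k.smul_mem _ hx.2⟩ }
  have hit2 : ∀ X : hC, θh X = X → (∀ i, (RS.root i X).im = 0) → Complex.I • (X : gC) ∈ k := by
    intro X hX hXr
    have h1 : hC.toSubmodule ≤ SatakeAux.cplx itR ⊔ Submodule.span ℂ (a : Set gC) := by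
      conv_lhs => rw [← hspan]
      rw [Submodule.span_le]
      rintro x (hx | hx)
      · exact Submodule.mem_sup_left (SatakeAux.le_cplx (m := itR) hx)
      · exact Submodule.mem_sup_right (Submodule.subset_span hx)
    obtain ⟨z1, ⟨u1, hu1, u2, hu2, rfl⟩, z2, hz2, e⟩ := Submodule.mem_sup.1 (h1 X.2)
    have hz2θ : θ z2 = -z2 := by
      clear e
      induction hz2 using Submodule.span_induction with
      | mem x h => exact hθa x h
      | zero => simp
      | add x y _ _ h1 h2 => rw [map_add, h1, h2, neg_add]
      | smul c x _ h => rw [map_smul, h, smul_neg]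
    have hz1θ : θ (u1 + Complex.I • u2) = u1 + Complex.I • u2 := by
      rw [map_add, map_smul, hθit u1 hu1.2, hθit u2 hu2.2]
    have hz20 : z2 = 0 := by
      have h2 : θ (X : gC) = X := congrArg Subtype.val hX
      rw [← e, map_add, hz1θ, hz2θ] at h2
      have h3 := add_left_cancel h2
      have h4 : (2 : ℂ) • z2 = 0 := by
        rw [two_smul]
        nth_rewrite 1 [← h3]
        exact neg_add_cancel z2
      exact (smul_eq_zero.1 h4).resolve_left two_ne_zero
    have hX' : X = ⟨u1, hu1.1⟩ + Complex.I • ⟨u2, hu2.1⟩ := Subtype.ext (by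
      rw [← e, hz20, add_zero]; rfl)
    have hu20 : (⟨u2, hu2.1⟩ : hC) = 0 := by
      apply SatakeAux.root_sep RS
      intro i
      change RS.root i ⟨u2, hu2.1⟩ = 0
      have h2 := hXr i
      rw [hX', map_add, map_smul, smul_eq_mul, Complex.add_im, Complex.I_mul_im,
        (hit1 ⟨u1, hu1.1⟩ hu1.2).2 i, zero_add] at h2
      exact Complex.ext h2 ((hit1 ⟨u2, hu2.1⟩ hu2.2).2 i)
    rw [hX', hu20, smul_zero, add_zero]
    exact hu1.2
  -- transfer
  let T' : Set hC := {X | (X : gC) ∈ T}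
  have hTmem : ∀ x ∈ T, x ∈ hC := by
    intro x hx
    rcases hT2 x hx with ⟨α, hα, -, rfl⟩ | ⟨α, β, h, rfl⟩
    · obtain ⟨i, -, rfl⟩ := hidx α hα
      rw [hHc]; exact (RS.coroot i).2
    · obtain ⟨i, -, rfl⟩ := hidx α h.1
      obtain ⟨j, -, rfl⟩ := hidx β h.2.1
      rw [hHc, hHc]; exact sub_mem (RS.coroot i).2 (RS.coroot j).2
  obtain ⟨hLI, hsp⟩ := SatakeAux.abstract_basis RS b θh hθhh V
    (fun i hi => by simpa using hVc i hi) τ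
    (fun i hi hiV => by
      obtain ⟨t1, t2, t3, -, t5⟩ := hτ i hi hiV
      exact ⟨t1, t2, t3, t5⟩) T'
    (by
      intro i hi hiV
      change (RS.coroot i : gC) ∈ T
      rw [← hHc]
      exact hT1 _ ((hsupp i).1 hi) hiV)
    (by
      intro X hX
      rcases hT2 X hX with ⟨α, hα, hαV, e⟩ | ⟨α, β, h, e⟩
      · obtain ⟨i, hi, rfl⟩ := hidx α hα
        exact Or.inl ⟨i, hi, hαV, Subtype.ext (by rw [e, hHc])⟩
      · obtain ⟨i, hi, hiV, hne, rfl, rfl⟩ := harrow2 α β h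
        exact Or.inr ⟨i, hi, hiV, hne, Subtype.ext (by rw [e, hHc, hHc]; rfl)⟩)
    (by
      intro i hi hiV hne
      have := hT3 _ _ (harrow1 i hi hiV hne)
      rw [hHc, hHc] at this
      exact this)
    (by
      intro i hi hiV hne
      have := hT4 _ _ (harrow1 i hi hiV hne)
      rw [hHc, hHc] at this
      exact this)
  let f : hC →ₗ[ℝ] gC := hC.toSubmodule.subtype.restrictScalars ℝ
  have hf : ∀ X, f X = X := fun _ => rfl
  constructor
  · have h1 := hLI.map' f (LinearMap.ker_eq_bot.2 Subtype.val_injective)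
    let e : T → T' := fun x => ⟨⟨x, hTmem x x.2⟩, x.2⟩
    have he : Function.Injective e := by
      intro x y h
      have := congrArg (fun z : T' => ((z : hC) : gC)) h
      exact Subtype.ext this
    exact h1.comp e he
  · apply le_antisymm
    · rw [Submodule.span_le]
      intro x hx
      have h1 := (hsp ⟨x, hTmem x hx⟩).1 (Submodule.subset_span hx)
      exact Submodule.subset_span ⟨hTmem x hx, hit2 ⟨x, hTmem x hx⟩ h1.1 h1.2⟩
    · rw [Submodule.span_le]
      rintro x ⟨hx, hxk⟩
      have h1 := (hsp ⟨x, hx⟩).2 (hit1 ⟨x, hx⟩ hxk)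
      have h2 : f ⟨x, hx⟩ ∈ (Submodule.span ℝ T').map f := ⟨_, h1, rfl⟩
      rw [Submodule.map_span] at h2
      refine Submodule.span_mono ?_ h2
      rintro _ ⟨X, hX, rfl⟩
      exact hX

end SmallestOrbitPaper
end
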